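/- Assume μ ≥ 0, λ ≥ μ, and −1 < δ ≤ λ. Then there exists a constant c > 0 such that for all integers n ≥ 2: if δ = λ then T_n^δ(w_{λ,μ};1) ≥ c log n and T_n^δ(w_{μ,λ};0) ≥ c log n, while if −1 < δ < λ then T_n^δ(w_{λ,μ};1) ≥ c n^{λ−δ} and T_n^δ(w_{μ,λ};0) ≥ c n^{λ−δ}. -/

import Mathlib

open MeasureTheory Finset Real intervalIntegral

/-- Generalized binomial coefficient `C(x, k) = x (x-1) ⋯ (x-k+1) / k!`. -/
noncomputable def genBinom (x : ℝ) (k : ℕ) : ℝ :=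
  (∏ i ∈ Finset.range k, (x - i)) / (Nat.factorial k)

/-- Cesàro coefficient `A_m^δ = C(m+δ, m)`. -/
noncomputable def cesA (δ : ℝ) (m : ℕ) : ℝ := genBinom (m + δ) m

/-- The generalized Gegenbauer weight `w_{λ,μ}(t) = |t|^{2μ} (1-t²)^{λ-1/2}`. -/
noncomputable def wGG (l m t : ℝ) : ℝ := |t| ^ (2 * m) * (1 - t ^ 2) ^ (l - 1 / 2)

/-- The Cesàro `(C,δ)` kernel built from a family `p` of orthonormal polynomials. -/
noncomputable def cesKer (p : ℕ → Polynomial ℝ) (δ : ℝ) (n : ℕ) (s t : ℝ) : ℝ :=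
  (cesA δ n)⁻¹ * ∑ k ∈ Finset.range (n + 1), cesA δ (n - k) * (p k).eval s * (p k).eval t

/-- `T_n^δ(w_{λ,μ}; t) = ∫_{-1}^1 |K_n^δ(w_{λ,μ}; s, t)| w_{λ,μ}(s) ds`. -/
noncomputable def TGG (p : ℕ → Polynomial ℝ) (l m δ : ℝ) (n : ℕ) (t : ℝ) : ℝ :=
  ∫ s in (-1 : ℝ)..1, |cesKer p δ n s t| * wGG l m s

/-- Cosine coefficients of the Jacobi polynomials: with `u = jacCoef a b j`, the function
`∑_{r < j} u r * cos ((j - r) φ) + u j / 2` is, up to a constant factor, the Jacobi polynomial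
`P_j^{(a - 1/2, b - 1/2)}` at `cos φ`. -/
noncomputable def jacCoef (a b : ℝ) (j : ℕ) : ℕ → ℝ
  | 0 => 1
  | 1 => 2 * (a - b) * j / (2 * j - 1 + (a + b))
  | (r + 2) => ((2 * j - r) * (r + (a + b)) * jacCoef a b j r
      + 2 * (a - b) * (j - r - 1) * jacCoef a b j (r + 1)) / ((r + 2) * (2 * j - r - 2 + (a + b)))

section JacCoef

variable {a b : ℝ} {j : ℕ}

theorem jacCoef_zero : jacCoef a b j 0 = 1 := by
  simp [jacCoef]

theorem jacCoef_one_mul (hb : 0 ≤ b) (hab : b ≤ a) (hj : 1 ≤ j) :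
    (2 * j - 1 + (a + b)) * jacCoef a b j 1 = 2 * (a - b) * j := by
  have hj' : (1 : ℝ) ≤ j := by exact_mod_cast hj
  have : (2 * j - 1 + (a + b) : ℝ) ≠ 0 := by nlinarith
  rw [jacCoef]
  field_simp

theorem jacCoef_add_two_mul (hb : 0 ≤ b) (hab : b ≤ a) {r : ℕ} (hr : r + 2 ≤ j) :
    (r + 2) * (2 * j - r - 2 + (a + b)) * jacCoef a b j (r + 2)
      = (2 * j - r) * (r + (a + b)) * jacCoef a b j r
        + 2 * (a - b) * (j - r - 1) * jacCoef a b j (r + 1) := by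
  have hj' : (r + 2 : ℝ) ≤ j := by exact_mod_cast hr
  have h0 : (0 : ℝ) ≤ r := Nat.cast_nonneg r
  have h1 : (2 * j - r - 2 + (a + b) : ℝ) ≠ 0 := by nlinarith
  have h2 : (r + 2 : ℝ) ≠ 0 := by nlinarith
  rw [jacCoef]
  field_simp

theorem jacCoef_nonneg (hb : 0 ≤ b) (hab : b ≤ a) : ∀ r : ℕ, r ≤ j → 0 ≤ jacCoef a b j r
  | 0, _ => by simp [jacCoef]
  | 1, h => by
    have hj' : (1 : ℝ) ≤ j := by exact_mod_cast h
    rw [jacCoef]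
    have : 0 ≤ a - b := by linarith
    apply div_nonneg (by positivity) (by linarith)
  | (r + 2), h => by
    have hj' : (r + 2 : ℝ) ≤ j := by exact_mod_cast h
    have h0 : (0 : ℝ) ≤ r := Nat.cast_nonneg r
    have ih := jacCoef_nonneg hb hab r (by omega)
    have ih' := jacCoef_nonneg hb hab (r + 1) (by omega)
    rw [jacCoef]
    have h1 : 0 ≤ a - b := by linarith
    have h2 : (0 : ℝ) ≤ 2 * j - r := by linarith
    have h3 : (0 : ℝ) ≤ j - r - 1 := by linarith
    have h4 : (0 : ℝ) ≤ 2 * j - r - 2 + (a + b) := by linarith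
    have h5 : 0 ≤ r + (a + b) := by linarith
    positivity

/-- The recurrence for `jacCoef` summed over an initial segment. -/
theorem jacCoef_summed_recurrence (hb : 0 ≤ b) (hab : b ≤ a) {l : ℕ} (hl : l + 1 ≤ j) :
    (l + 1) * (2 * j - l - 1 + (a + b)) * jacCoef a b j (l + 1)
        + l * (2 * j - l + (a + b)) * jacCoef a b j l
      = 4 * a * ∑ r ∈ range l, (j - r : ℝ) * jacCoef a b j r
        + 2 * (a - b) * (j - l) * jacCoef a b j l := by
  induction l with
  | zero =>
    have := jacCoef_one_mul hb hab hl
    simp [jacCoef_zero]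
    linarith
  | succ l ih =>
    have ih := ih (by omega)
    have h := jacCoef_add_two_mul hb hab hl
    rw [sum_range_succ]
    push_cast
    have e : ((l + 1 : ℝ) + 1) * (2 * j - (l + 1) - 1 + (a + b)) * jacCoef a b j (l + 1 + 1)
      = (l + 2) * (2 * j - l - 2 + (a + b)) * jacCoef a b j (l + 2) := by ring
    rw [e, h]
    linear_combination ih

theorem jacCoef_weighted_sum_step (hb : 0 ≤ b) (hab : b ≤ a) {k : ℕ} (hk : 2 * (k + 1) ≤ j) :
    (∑ r ∈ range (2 * k + 1), (j - r : ℝ) * jacCoef a b j r)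
        * (1 + a / (k + 1) - (a * (a + b + 4) / 2) / j)
      ≤ ∑ r ∈ range (2 * (k + 1) + 1), (j - r : ℝ) * jacCoef a b j r := by
  have hk' : (2 * (k + 1) : ℝ) ≤ j := by exact_mod_cast hk
  have hk0 : (0 : ℝ) ≤ k := Nat.cast_nonneg k
  have ha : 0 ≤ a := hb.trans hab
  have hj : (0 : ℝ) < j := by linarith
  set W := ∑ r ∈ range (2 * k + 1), (j - r : ℝ) * jacCoef a b j r with hW
  have hW0 : 0 ≤ W := by
    refine sum_nonneg fun r hr => mul_nonneg ?_ (jacCoef_nonneg hb hab r ?_)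
    · have : (r : ℝ) ≤ j := by
        have := mem_range.1 hr
        exact_mod_cast (by omega : r ≤ j)
      linarith
    · have := mem_range.1 hr
      omega
  have hrec := jacCoef_summed_recurrence hb hab (l := 2 * k + 1) (by omega)
  have hu1 := jacCoef_nonneg (j := j) hb hab (2 * k + 1) (by omega)
  have hu2 := jacCoef_nonneg (j := j) hb hab (2 * k + 1 + 1) (by omega)
  rw [← hW] at hrec
  rw [show 2 * (k + 1) + 1 = 2 * k + 1 + 1 + 1 by ring, sum_range_succ, sum_range_succ, ← hW]
  push_cast at hrec ⊢
  set u := jacCoef a b j (2 * k + 1)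
  set v := jacCoef a b j (2 * k + 1 + 1)
  have h1 : 4 * a * W ≤ 2 * (k + 1) * (2 * j + (a + b)) * (u + v) := by
    have e1 : 0 ≤ 2 * (a - b) * (j - (2 * k + 1)) * u := by
      have : 0 ≤ a - b := by linarith
      have : (0 : ℝ) ≤ j - (2 * k + 1) := by linarith
      positivity
    have e2 : (2 * k + 1 + 1) * (2 * j - (2 * k + 1) - 1 + (a + b)) * v
        ≤ 2 * (k + 1) * (2 * j + (a + b)) * v := by
      apply mul_le_mul_of_nonneg_right _ hu2
      nlinarith
    have e3 : (2 * k + 1) * (2 * j - (2 * k + 1) + (a + b)) * u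
        ≤ 2 * (k + 1) * (2 * j + (a + b)) * u := by
      apply mul_le_mul_of_nonneg_right _ hu1
      have : (0 : ℝ) ≤ 2 * j - (2 * k + 1) + (a + b) := by linarith
      nlinarith
    linarith
  have hs : 0 < 2 * (k + 1) * (2 * j + (a + b)) := by positivity
  have h2 : 4 * a * W / (2 * (k + 1) * (2 * j + (a + b))) ≤ u + v := by
    rw [div_le_iff₀ hs]
    linarith
  have h3 : (j - 2 * (k + 1)) * (u + v) ≤ (j - (2 * k + 1)) * u + (j - (2 * k + 1 + 1)) * v := by
    nlinarith
  have h4 : (j - 2 * (k + 1)) * (4 * a * W / (2 * (k + 1) * (2 * j + (a + b))))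
      ≤ (j - 2 * (k + 1)) * (u + v) :=
    mul_le_mul_of_nonneg_left h2 (by linarith)
  have h5 : W * (a / (k + 1) - (a * (a + b + 4) / 2) / j)
      ≤ (j - 2 * (k + 1)) * (4 * a * W / (2 * (k + 1) * (2 * j + (a + b)))) := by
    have e : (j - 2 * (k + 1)) * (4 * a * W / (2 * (k + 1) * (2 * j + (a + b))))
        = W * (2 * a * (j - 2 * (k + 1)) / ((k + 1) * (2 * j + (a + b)))) := by
      field_simp
      ring
    rw [e]
    apply mul_le_mul_of_nonneg_left _ hW0
    have hp : 0 < (k + 1 : ℝ) * (2 * j + (a + b)) := by positivity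
    rw [le_div_iff₀ hp]
    have e : (a / (k + 1) - (a * (a + b + 4) / 2) / j) * ((k + 1) * (2 * j + (a + b)))
        = a * (2 * j + (a + b)) - (a * (a + b + 4) / 2) * (k + 1) * (2 + (a + b) / j) := by
      field_simp
    rw [e]
    have hq : 0 ≤ (a + b) / j := by positivity
    have : (a * (a + b + 4) / 2) * (k + 1) * 2
        ≤ (a * (a + b + 4) / 2) * (k + 1) * (2 + (a + b) / j) := by
      apply mul_le_mul_of_nonneg_left _ (by positivity)
      linarith
    have : 0 ≤ a * (a + b) * k := by positivity
    linarith
  calc W * (1 + a / (k + 1) - (a * (a + b + 4) / 2) / j)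
      = W + W * (a / (k + 1) - (a * (a + b + 4) / 2) / j) := by ring
    _ ≤ _ := by linarith

theorem cesA_zero_right (d : ℝ) : cesA d 0 = 1 := by
  simp [cesA, genBinom]

theorem cesA_eq_prod (d : ℝ) (m : ℕ) :
    cesA d m = ∏ i ∈ range m, (1 + d / (i + 1)) := by
  have h1 : ∏ i ∈ range m, (m + d - i : ℝ) = ∏ i ∈ range m, (i + 1 + d : ℝ) := by
    rw [← prod_range_reflect]
    refine prod_congr rfl fun i hi => ?_
    have := mem_range.1 hi
    rw [Nat.sub_sub, Nat.cast_sub (by omega)]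
    push_cast
    ring
  have h2 : (m.factorial : ℝ) = ∏ i ∈ range m, (i + 1 : ℝ) := by
    rw [← prod_range_add_one_eq_factorial]
    push_cast
    rfl
  rw [cesA, genBinom, h1, h2, ← prod_div_distrib]
  refine prod_congr rfl fun i _ => ?_
  have : (i + 1 : ℝ) ≠ 0 := by positivity
  field_simp

theorem cesA_succ (d : ℝ) (m : ℕ) : cesA d (m + 1) = cesA d m * (1 + d / (m + 1)) := by
  rw [cesA_eq_prod, cesA_eq_prod, prod_range_succ]

theorem cesA_pos {d : ℝ} (hd : -1 < d) (m : ℕ) : 0 < cesA d m := by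
  rw [cesA_eq_prod]
  refine prod_pos fun i _ => ?_
  have h : (0 : ℝ) < i + 1 := by positivity
  have : (0 : ℝ) ≤ i := by positivity
  rw [show 1 + d / (i + 1) = (i + 1 + d) / (i + 1 : ℝ) by field_simp]
  apply div_pos _ h
  linarith

theorem jacCoef_weighted_sum_ge (hb : 0 ≤ b) (hab : b ≤ a) (k : ℕ) (hk : 2 * k ≤ j)
    (hj : 1 ≤ j) (hck : a * (a + b + 4) / 2 * k ≤ j) :
    j * cesA a k * (1 - (a * (a + b + 4) / 2) * k / j)
      ≤ ∑ r ∈ range (2 * k + 1), (j - r : ℝ) * jacCoef a b j r := by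
  have hj' : (0 : ℝ) < j := by exact_mod_cast hj
  have ha : 0 ≤ a := hb.trans hab
  induction k with
  | zero => simp [cesA_zero_right, jacCoef_zero]
  | succ k ih =>
    refine le_trans ?_ (jacCoef_weighted_sum_step hb hab hk)
    have hk' : (2 * (k + 1) : ℝ) ≤ j := by exact_mod_cast hk
    set c := a * (a + b + 4) / 2 with hc
    have hc0 : 0 ≤ c := by positivity
    have hA := cesA_pos (d := a) (by linarith) k
    set W := ∑ r ∈ range (2 * k + 1), (j - r : ℝ) * jacCoef a b j r with hW
    have hWj : j * cesA a k * (1 - c * k / j) ≤ W := by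
      refine ih (by omega) (le_trans ?_ hck)
      gcongr
      simp
    have hW0 : 0 ≤ W := by
      refine sum_nonneg fun r hr => mul_nonneg ?_ (jacCoef_nonneg hb hab r ?_)
      · have : (r : ℝ) ≤ j := by
          have := mem_range.1 hr
          exact_mod_cast (by omega : r ≤ j)
        linarith
      · have := mem_range.1 hr
        omega
    have hak : 0 ≤ a / (k + 1 : ℝ) := by positivity
    rw [cesA_succ]
    push_cast
    have hcj : c / j ≤ 1 := by
      rw [div_le_one hj']
      have : (0 : ℝ) ≤ c * k := by positivity
      push_cast at hck
      linarith
    have hneg : 0 ≤ 1 + a / (k + 1) - c / j := by linarith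
    refine le_trans ?_ (mul_le_mul_of_nonneg_right hWj hneg)
    have : (0 : ℝ) ≤ c / j := by positivity
    have e : j * cesA a k * (1 - c * k / j) * (1 + a / (k + 1) - c / j)
        - j * (cesA a k * (1 + a / (k + 1))) * (1 - c * (k + 1) / j)
        = (j * cesA a k) * ((c / j) * (a / (k + 1) + c / j * k)) := by
      field_simp
      ring
    have : 0 ≤ (j * cesA a k) * ((c / j) * (a / (k + 1) + c / j * k)) := by positivity
    linarith

theorem exists_pos_bounds_of_tendsto {f : ℕ → ℝ} {L : ℝ} (hf : ∀ m, 0 < f m) (hL : 0 < L)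
    (h : Filter.Tendsto f Filter.atTop (nhds L)) :
    ∃ c C : ℝ, 0 < c ∧ 0 < C ∧ ∀ m, c ≤ f m ∧ f m ≤ C := by
  obtain ⟨C, hC⟩ := h.bddAbove_range
  obtain ⟨c, hc⟩ := (h.inv₀ hL.ne').bddAbove_range
  have hC' : ∀ m, f m ≤ C := fun m => hC ⟨m, rfl⟩
  have hc' : ∀ m, (f m)⁻¹ ≤ c := fun m => hc ⟨m, rfl⟩
  have hc0 : 0 < c := lt_of_lt_of_le (inv_pos.2 (hf 0)) (hc' 0)
  exact ⟨c⁻¹, C, inv_pos.2 hc0, lt_of_lt_of_le (hf 0) (hC' 0), fun m =>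
    ⟨(inv_le_comm₀ (hf m) hc0).1 (hc' m), hC' m⟩⟩

theorem cesA_mul_GammaSeq {d : ℝ} (hd : -1 < d) (m : ℕ) :
    cesA d (m + 1) * Real.GammaSeq (d + 1) m = (m : ℝ) ^ (d + 1) / (m + 1) := by
  have h1 : cesA d (m + 1) = (∏ i ∈ range (m + 1), (d + 1 + i)) / ((m + 1).factorial : ℝ) := by
    rw [cesA_eq_prod, ← prod_range_add_one_eq_factorial]
    push_cast
    rw [← prod_div_distrib]
    refine prod_congr rfl fun i _ => ?_
    have : (i + 1 : ℝ) ≠ 0 := by positivity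
    field_simp
    ring
  have h2 : (0 : ℝ) < ∏ i ∈ range (m + 1), (d + 1 + i) :=
    prod_pos fun i _ => by
      have : (0 : ℝ) ≤ i := by positivity
      linarith
  rw [h1, Real.GammaSeq, Nat.factorial_succ]
  push_cast
  have := h2.ne'
  have h3 : (m.factorial : ℝ) ≠ 0 := by positivity
  have h4 : (m + 1 : ℝ) ≠ 0 := by positivity
  field_simp

theorem tendsto_cesA_div {d : ℝ} (hd : -1 < d) :
    Filter.Tendsto (fun m : ℕ => cesA d m / (m + 1 : ℝ) ^ d) Filter.atTop
      (nhds (Real.Gamma (d + 1))⁻¹) := by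
  have hG : 0 < Real.Gamma (d + 1) := Real.Gamma_pos_of_pos (by linarith)
  rw [← Filter.tendsto_add_atTop_iff_nat 1]
  have t1 : Filter.Tendsto (fun m : ℕ => (m : ℝ) / (m + 1)) Filter.atTop (nhds 1) :=
    tendsto_natCast_div_add_atTop 1
  have t2 : Filter.Tendsto (fun m : ℕ => (m : ℝ) / (m + 2)) Filter.atTop (nhds 1) :=
    tendsto_natCast_div_add_atTop 2
  have t3 := (t1.mul (t2.rpow_const (p := d) (Or.inl one_ne_zero))).mul
    ((Real.GammaSeq_tendsto_Gamma (d + 1)).inv₀ hG.ne')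
  simp only [Real.one_rpow, one_mul] at t3
  refine t3.congr' ?_
  filter_upwards [Filter.eventually_ge_atTop 1] with m hm
  have hm0 : (0 : ℝ) < m := by exact_mod_cast hm
  have h := cesA_mul_GammaSeq hd m
  have hpos : (0 : ℝ) < (m : ℝ) ^ (d + 1) / (m + 1) := by positivity
  have hS : Real.GammaSeq (d + 1) m ≠ 0 := by
    intro h0
    rw [h0, mul_zero] at h
    exact hpos.ne h
  rw [← eq_div_iff hS] at h
  rw [h, Real.div_rpow hm0.le (by positivity), Real.rpow_add_one hm0.ne']
  push_cast
  rw [show (m + 1 + 1 : ℝ) = m + 2 by ring]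
  have : (0 : ℝ) < (m + 2 : ℝ) ^ d := by positivity
  field_simp

theorem exists_cesA_bounds {d : ℝ} (hd : -1 < d) :
    ∃ c C : ℝ, 0 < c ∧ 0 < C ∧
      ∀ m : ℕ, c * (m + 1 : ℝ) ^ d ≤ cesA d m ∧ cesA d m ≤ C * (m + 1 : ℝ) ^ d := by
  obtain ⟨c, C, hc, hC, h⟩ := exists_pos_bounds_of_tendsto
    (fun m => div_pos (cesA_pos hd m) (by positivity))
    (inv_pos.2 (Real.Gamma_pos_of_pos (by linarith))) (tendsto_cesA_div hd)
  refine ⟨c, C, hc, hC, fun m => ?_⟩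
  have hp : (0 : ℝ) < (m + 1 : ℝ) ^ d := by positivity
  exact ⟨(le_div_iff₀ hp).1 (h m).1, (div_le_iff₀ hp).1 (h m).2⟩

theorem exists_jacCoef_sum_ge (hb : 0 ≤ b) (hab : b ≤ a) :
    ∃ c : ℝ, 0 < c ∧ ∃ D : ℕ, 2 ≤ D ∧ ∀ j l : ℕ, l * D ≤ j →
      c * (l + 1 : ℝ) ^ a ≤ ∑ r ∈ range (l + 1), jacCoef a b j r := by
  have ha : 0 ≤ a := hb.trans hab
  obtain ⟨c, C, hc, hC, hA⟩ := exists_cesA_bounds (d := a) (by linarith)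
  set K := a * (a + b + 4) / 2 with hK
  have hK0 : 0 ≤ K := by positivity
  refine ⟨min 1 (c / 2 * (1 / 2) ^ a), by positivity, ⌈K⌉₊ + 2, by omega, fun j l hl => ?_⟩
  rcases Nat.eq_zero_or_pos l with rfl | hl0
  · simp [jacCoef_zero]
  have hlj : l ≤ j := le_trans (Nat.le_mul_of_pos_right l (by omega)) hl
  have hj : (0 : ℝ) < j := by exact_mod_cast lt_of_lt_of_le hl0 hlj
  set k := l / 2 with hk
  have hkl : (2 * k : ℝ) ≤ l := by exact_mod_cast (by omega : 2 * k ≤ l)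
  have hlk : (l + 1 : ℝ) ≤ 2 * (k + 1) := by exact_mod_cast (by omega : l + 1 ≤ 2 * (k + 1))
  have hKl : K * l ≤ j := by
    have h1 : (l : ℝ) * (⌈K⌉₊ + 2) ≤ j := by exact_mod_cast hl
    have h2 := Nat.le_ceil K
    have h3 : (0 : ℝ) < l := by exact_mod_cast hl0
    nlinarith
  have hKk : 2 * (K * k) ≤ j := by nlinarith
  have hKk0 : 0 ≤ K * k := by positivity
  have hW := jacCoef_weighted_sum_ge hb hab k (j := j) (by omega) (by omega)
    (by rw [← hK]; linarith)
  rw [← hK] at hW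
  have h1 : ∑ r ∈ range (2 * k + 1), (j - r : ℝ) * jacCoef a b j r
      ≤ j * ∑ r ∈ range (l + 1), jacCoef a b j r := by
    rw [mul_sum]
    refine (sum_le_sum fun r hr => ?_).trans
      (sum_le_sum_of_subset_of_nonneg (range_mono (by omega)) fun r hr _ => ?_)
    · have := mem_range.1 hr
      exact mul_le_mul_of_nonneg_right (by simp) (jacCoef_nonneg hb hab r (by omega))
    · have := mem_range.1 hr
      exact mul_nonneg hj.le (jacCoef_nonneg hb hab r (by omega))
  have h2 : (1 : ℝ) / 2 ≤ 1 - K * k / j := by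
    have : K * k / j ≤ 1 / 2 := by
      rw [div_le_iff₀ hj]
      linarith
    linarith
  have h3 : (j : ℝ) * (cesA a k * (1 / 2)) ≤ j * ∑ r ∈ range (l + 1), jacCoef a b j r := by
    refine le_trans ?_ (hW.trans h1)
    rw [mul_assoc]
    have := cesA_pos (d := a) (by linarith) k
    gcongr
  have h4 := le_of_mul_le_mul_left h3 hj
  calc min 1 (c / 2 * (1 / 2) ^ a) * (l + 1 : ℝ) ^ a
      ≤ (c / 2 * (1 / 2) ^ a) * (2 * (k + 1) : ℝ) ^ a := by
        gcongr
        exact min_le_right _ _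
    _ = c * (k + 1 : ℝ) ^ a * (1 / 2) := by
        rw [Real.mul_rpow (by norm_num) (by positivity), Real.div_rpow (by norm_num) (by norm_num),
          Real.one_rpow]
        have : (2 : ℝ) ^ a ≠ 0 := by positivity
        field_simp
    _ ≤ cesA a k * (1 / 2) := by
        gcongr
        exact (hA k).1
    _ ≤ _ := h4

end JacCoef

/-- A constant multiple of the Jacobi polynomial `P_j^{(a - 1/2, b - 1/2)}`. -/
noncomputable def jacPoly (a b : ℝ) (j : ℕ) : Polynomial ℝ :=
  ∑ r ∈ range j, jacCoef a b j r • Polynomial.Chebyshev.T ℝ ((j : ℤ) - r)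
    + (jacCoef a b j j / 2) • (1 : Polynomial ℝ)

/-- The Jacobi differential operator. -/
noncomputable def jacOp (a b : ℝ) : Polynomial ℝ →ₗ[ℝ] Polynomial ℝ where
  toFun f := (1 - Polynomial.X ^ 2) * f.derivative.derivative
    + (Polynomial.C (b - a) - Polynomial.C (a + b + 1) * Polynomial.X) * f.derivative
  map_add' f g := by
    simp only [Polynomial.derivative_add]
    ring
  map_smul' c f := by
    simp only [Polynomial.derivative_smul, RingHom.id_apply]
    simp only [Polynomial.smul_eq_C_mul]
    ring

theorem jacOp_apply (a b : ℝ) (f : Polynomial ℝ) :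
    jacOp a b f = (1 - Polynomial.X ^ 2) * f.derivative.derivative
      + (Polynomial.C (b - a) - Polynomial.C (a + b + 1) * Polynomial.X) * f.derivative := rfl

open Polynomial in
theorem jacOp_T_eval (a b ν x : ℝ) (i : ℤ) :
    2 * ((jacOp a b (Chebyshev.T ℝ i)).eval x + ν * (Chebyshev.T ℝ i).eval x)
      = (ν - i ^ 2 - (a + b) * i) * (Chebyshev.U ℝ i).eval x
        - (ν - i ^ 2 + (a + b) * i) * (Chebyshev.U ℝ (i - 2)).eval x
        - 2 * (a - b) * i * (Chebyshev.U ℝ (i - 1)).eval x := by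
  have h1 := congrArg (Polynomial.eval x)
    (Chebyshev.one_sub_X_sq_mul_derivative_derivative_T_eq_poly_in_T (R := ℝ) i)
  have h2 := congrArg (Polynomial.eval x) (Chebyshev.two_mul_T_eq_U_sub_U ℝ (i - 2))
  have h3 := congrArg (Polynomial.eval x) (Chebyshev.U_eq ℝ i)
  rw [sub_add_cancel] at h2
  rw [jacOp_apply]
  simp only [Function.iterate_succ, Function.iterate_zero, Function.comp_apply, id] at h1
  simp only [eval_mul, eval_sub, eval_add, eval_pow, eval_X, eval_one, eval_C, eval_intCast,
    eval_ofNat, Chebyshev.T_derivative_eq_U] at h1 h2 h3 ⊢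
  linear_combination 2 * h1 + (ν - i ^ 2) * h2 + (a + b) * i * h3

open Polynomial in
theorem jacPoly_partial_sum {a b : ℝ} (hb : 0 ≤ b) (hab : b ≤ a) {j R : ℕ} (hR : R + 1 ≤ j)
    (x : ℝ) :
    ∑ r ∈ range (R + 1), jacCoef a b j r *
      (2 * ((jacOp a b (Chebyshev.T ℝ ((j : ℤ) - r))).eval x
        + j * (j + (a + b)) * (Chebyshev.T ℝ ((j : ℤ) - r)).eval x))
      = -((R + 1) * (2 * j - R - 1 + (a + b)) * jacCoef a b j (R + 1)
            * (Chebyshev.U ℝ ((j : ℤ) - R - 1)).eval x)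
        - (2 * j - R) * (R + (a + b)) * jacCoef a b j R
            * (Chebyshev.U ℝ ((j : ℤ) - R - 2)).eval x := by
  induction R with
  | zero =>
    have h := jacCoef_one_mul hb hab hR
    rw [sum_range_one, jacOp_T_eval]
    simp only [jacCoef_zero, Nat.cast_zero, sub_zero, zero_add]
    push_cast
    linear_combination (Chebyshev.U ℝ ((j : ℤ) - 1)).eval x * h
  | succ R ih =>
    have h := jacCoef_add_two_mul hb hab hR
    rw [sum_range_succ, ih (by omega), jacOp_T_eval]
    rw [show (j : ℤ) - (R + 1 : ℕ) - 1 = j - R - 2 by push_cast; ring,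
      show (j : ℤ) - (R + 1 : ℕ) - 2 = j - R - 3 by push_cast; ring,
      show (j : ℤ) - (R + 1 : ℕ) = j - R - 1 by push_cast; ring,
      show R + 1 + 1 = R + 2 by ring]
    push_cast
    linear_combination (Chebyshev.U ℝ ((j : ℤ) - R - 2)).eval x * h

open Polynomial in
theorem jacOp_jacPoly {a b : ℝ} (hb : 0 ≤ b) (hab : b ≤ a) (j : ℕ) :
    jacOp a b (jacPoly a b j) = -((j * (j + (a + b)) : ℝ) • jacPoly a b j) := by
  refine Polynomial.funext fun x => ?_
  rw [eval_neg, eval_smul, smul_eq_mul, eq_neg_iff_add_eq_zero]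
  rcases Nat.eq_zero_or_pos j with rfl | hj
  · simp [jacPoly, jacOp_apply]
  obtain ⟨R, rfl⟩ : ∃ R, j = R + 1 := ⟨j - 1, by omega⟩
  have h := jacPoly_partial_sum hb hab (le_refl (R + 1)) x
  have h0 : jacOp a b (1 : Polynomial ℝ) = 0 := by simp [jacOp_apply]
  rw [jacPoly, map_add, map_sum]
  simp only [map_smul, h0, smul_zero, add_zero, eval_finsetSum, eval_smul, smul_eq_mul, eval_add,
    eval_one, mul_one]
  rw [show ((R + 1 : ℕ) : ℤ) - R - 1 = 0 by push_cast; ring,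
    show ((R + 1 : ℕ) : ℤ) - R - 2 = -1 by push_cast; ring] at h
  simp only [Chebyshev.U_zero, Chebyshev.U_neg_one, eval_one, eval_zero] at h
  have h' : ∀ A B : ℕ → ℝ, ∀ ν : ℝ, ∑ r ∈ range (R + 1), jacCoef a b (R + 1) r *
      (2 * (A r + ν * B r)) = 2 * (∑ r ∈ range (R + 1), jacCoef a b (R + 1) r * A r
        + ν * ∑ r ∈ range (R + 1), jacCoef a b (R + 1) r * B r) := by
    intro A B ν
    rw [mul_sum, ← sum_add_distrib, mul_sum]
    exact sum_congr rfl fun r _ => by ring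
  rw [h' (fun r => _) (fun r => _)] at h
  push_cast at h ⊢
  linear_combination h / 2

/-- The weight `w_{a,b}` transported to the circle by `t = cos θ`. -/
noncomputable def circWeight (a b θ : ℝ) : ℝ := |sin θ| ^ (2 * a) * |cos θ| ^ (2 * b)

theorem circWeight_nonneg (a b θ : ℝ) : 0 ≤ circWeight a b θ := by
  unfold circWeight
  positivity

theorem continuous_circWeight {a b : ℝ} (ha : 0 ≤ a) (hb : 0 ≤ b) :
    Continuous (circWeight a b) := by
  unfold circWeight
  exact (continuous_sin.abs.rpow_const fun _ => Or.inr (by linarith)).mul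
    (continuous_cos.abs.rpow_const fun _ => Or.inr (by linarith))

theorem hasDerivAt_abs_rpow_of_ne {y : ℝ} (hy : y ≠ 0) (p : ℝ) :
    HasDerivAt (fun y => |y| ^ p) (p * |y| ^ p / y) y := by
  have h := (hasDerivAt_abs hy).rpow_const (p := p) (Or.inl (abs_ne_zero.2 hy))
  convert h using 1
  rw [Real.rpow_sub_one (abs_ne_zero.2 hy)]
  rcases hy.lt_or_gt with h | h
  · simp [abs_of_neg h, h]
    field_simp
  · simp [abs_of_pos h, h]
    field_simp

theorem hasDerivAt_circWeight (a b : ℝ) {θ : ℝ} (hs : sin θ ≠ 0) (hc : cos θ ≠ 0) :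
    HasDerivAt (circWeight a b)
      (circWeight a b θ * (2 * a * cos θ / sin θ - 2 * b * sin θ / cos θ)) θ := by
  have h1 := (hasDerivAt_abs_rpow_of_ne hs (2 * a)).comp θ (hasDerivAt_sin θ)
  have h2 := (hasDerivAt_abs_rpow_of_ne hc (2 * b)).comp θ (hasDerivAt_cos θ)
  refine (h1.mul h2).congr_deriv ?_
  simp only [circWeight, Function.comp_apply]
  field_simp
  ring

/-- Integration against the Jacobi weight in the variable `x = cos (2 θ)`. -/
noncomputable def jacInt {a b : ℝ} (ha : 0 ≤ a) (hb : 0 ≤ b) : Polynomial ℝ →ₗ[ℝ] ℝ where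
  toFun f := ∫ θ in (0 : ℝ)..π, f.eval (cos (2 * θ)) * circWeight a b θ
  map_add' f g := by
    have hw := continuous_circWeight ha hb
    rw [← intervalIntegral.integral_add]
    · refine intervalIntegral.integral_congr fun θ _ => ?_
      simp only [Polynomial.eval_add]
      ring
    all_goals exact Continuous.intervalIntegrable (by fun_prop) _ _
  map_smul' c f := by
    simp [mul_assoc]

theorem jacInt_apply {a b : ℝ} (ha : 0 ≤ a) (hb : 0 ≤ b) (f : Polynomial ℝ) :
    jacInt ha hb f = ∫ θ in (0 : ℝ)..π, f.eval (cos (2 * θ)) * circWeight a b θ := rfl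

open Polynomial in
theorem jacInt_moment {a b : ℝ} (ha : 0 ≤ a) (hb : 0 ≤ b) (h : Polynomial ℝ) :
    jacInt ha hb ((1 - X ^ 2) * h.derivative + (C (b - a) - C (a + b + 1) * X) * h) = 0 := by
  have hw := continuous_circWeight ha hb
  set F : ℝ → ℝ := fun θ => circWeight a b θ * (sin (2 * θ) * h.eval (cos (2 * θ))) with hF
  have key := MeasureTheory.integral_eq_of_hasDerivAt_off_countable_of_le F
    (fun θ => -2 * (((1 - X ^ 2) * h.derivative + (C (b - a) - C (a + b + 1) * X) * h).eval
      (cos (2 * θ)) * circWeight a b θ)) pi_pos.le (Set.countable_singleton (π / 2))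
    (by fun_prop)
    (by
      rintro θ ⟨⟨h0, hpi⟩, hne⟩
      have hs : sin θ ≠ 0 := (sin_pos_of_pos_of_lt_pi h0 hpi).ne'
      have hc : cos θ ≠ 0 := by
        intro hc
        apply hne
        have := injOn_cos ⟨h0.le, hpi.le⟩ ⟨by positivity, by linarith [pi_pos]⟩
          (hc.trans cos_pi_div_two.symm)
        exact this
      have d1 : HasDerivAt (fun θ : ℝ => 2 * θ) 2 θ := by
        simpa using (hasDerivAt_id θ).const_mul 2
      have d2 := (hasDerivAt_sin (2 * θ)).comp θ d1
      have d3 := (h.hasDerivAt (cos (2 * θ))).comp θ ((hasDerivAt_cos (2 * θ)).comp θ d1)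
      have d4 := (hasDerivAt_circWeight a b hs hc).mul (d2.mul d3)
      refine d4.congr_deriv ?_
      simp only [eval_add, eval_mul, eval_sub, eval_pow, eval_X, eval_one, eval_C,
        Function.comp_apply, Pi.mul_apply]
      have e1 : 1 - cos (2 * θ) ^ 2 = sin (2 * θ) ^ 2 := by
        rw [sin_sq]
      have e2 : (2 * a * cos θ / sin θ - 2 * b * sin θ / cos θ) * sin (2 * θ)
          = 2 * ((a - b) + (a + b) * cos (2 * θ)) := by
        rw [sin_two_mul, cos_two_mul]
        field_simp
        rw [sin_sq]
        ring
      rw [e1]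
      linear_combination (circWeight a b θ * h.eval (cos (2 * θ))) * e2)
    (by exact Continuous.intervalIntegrable (by fun_prop) _ _)
  rw [intervalIntegral.integral_const_mul] at key
  rw [jacInt_apply]
  have h0 : F 0 = 0 := by simp [hF]
  have h1 : F π = 0 := by simp [hF]
  rw [h0, h1] at key
  linarith

open Polynomial in
theorem jacInt_jacOp_mul {a b : ℝ} (ha : 0 ≤ a) (hb : 0 ≤ b) (f g : Polynomial ℝ) :
    jacInt ha hb (jacOp a b f * g) = jacInt ha hb (f * jacOp a b g) := by
  have h1 := jacInt_moment ha hb (f.derivative * g)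
  have h2 := jacInt_moment ha hb (g.derivative * f)
  rw [← sub_eq_zero, ← map_sub, ← sub_zero (0 : ℝ)]
  nth_rw 1 [← h1]
  rw [← h2, ← map_sub]
  congr 1
  simp only [jacOp_apply, derivative_mul]
  ring

open Polynomial in
theorem jacInt_jacPoly_mul_X_pow {a b : ℝ} (hb : 0 ≤ b) (hab : b ≤ a) {j : ℕ} (n : ℕ)
    (hn : n < j) : jacInt (hb.trans hab) hb (jacPoly a b j * X ^ n) = 0 := by
  induction n using Nat.strong_induction_on with
  | _ n ih =>
    have ha := hb.trans hab
    have h := jacInt_jacOp_mul ha hb (jacPoly a b j) (X ^ n)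
    rw [jacOp_jacPoly hb hab] at h
    have hD : ∃ q : Polynomial ℝ, jacInt ha hb (jacPoly a b j * q) = 0 ∧
        jacOp a b (X ^ n) = q - (n * (n + (a + b)) : ℝ) • X ^ n := by
      match n, ih, hn with
      | 0, _, _ => exact ⟨0, by simp, by simp [jacOp_apply]⟩
      | 1, ih, hn =>
        refine ⟨(b - a) • X ^ 0, ?_, ?_⟩
        · rw [mul_smul_comm, map_smul, ih 0 (by omega) (by omega), smul_zero]
        · simp [jacOp_apply, smul_eq_C_mul]
          ring
      | n + 2, ih, hn =>
        refine ⟨((n + 2) * (n + 1) : ℝ) • X ^ n + ((b - a) * (n + 2)) • X ^ (n + 1), ?_, ?_⟩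
        · rw [mul_add, map_add, mul_smul_comm, map_smul, mul_smul_comm, map_smul,
            ih n (by omega) (by omega), ih (n + 1) (by omega) (by omega)]
          simp
        · have h2 : (C (2 : ℝ) : ℝ[X]) = 2 := rfl
          simp [jacOp_apply, smul_eq_C_mul, h2]
          ring
    obtain ⟨q, hq, hD⟩ := hD
    rw [hD, neg_mul, map_neg, smul_mul_assoc, map_smul, mul_sub, map_sub, hq, mul_smul_comm,
      map_smul, smul_eq_mul, smul_eq_mul] at h
    have hnj : (n : ℝ) < j := by exact_mod_cast hn
    have h0 : (0 : ℝ) ≤ n := Nat.cast_nonneg n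
    have hne : (j * (j + (a + b)) - n * (n + (a + b)) : ℝ) ≠ 0 := by
      apply ne_of_gt
      nlinarith
    have : (j * (j + (a + b)) - n * (n + (a + b)) : ℝ)
        * jacInt ha hb (jacPoly a b j * X ^ n) = 0 := by linarith
    exact (mul_eq_zero.1 this).resolve_left hne

open Polynomial in
theorem jacInt_jacPoly_mul {a b : ℝ} (hb : 0 ≤ b) (hab : b ≤ a) {j : ℕ} {f : Polynomial ℝ}
    (hf : f.degree < j) : jacInt (hb.trans hab) hb (jacPoly a b j * f) = 0 := by
  rcases Nat.eq_zero_or_pos j with rfl | hj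
  · have : f = 0 := by simpa using hf
    simp [this]
  have hf' : f.natDegree < j := by
    rcases eq_or_ne f 0 with rfl | h0
    · simpa using hj
    · exact (natDegree_lt_iff_degree_lt h0).2 hf
  rw [as_sum_range' f j hf', mul_sum, map_sum]
  refine sum_eq_zero fun i hi => ?_
  rw [← C_mul_X_pow_eq_monomial, ← smul_eq_C_mul, mul_smul_comm, map_smul,
    jacInt_jacPoly_mul_X_pow hb hab i (mem_range.1 hi), smul_zero]

theorem circWeight_le_one {a b : ℝ} (ha : 0 ≤ a) (hb : 0 ≤ b) (θ : ℝ) : circWeight a b θ ≤ 1 := by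
  unfold circWeight
  have h1 := rpow_le_one (abs_nonneg _) (abs_sin_le_one θ) (show 0 ≤ 2 * a by linarith)
  have h2 := rpow_le_one (abs_nonneg _) (abs_cos_le_one θ) (show 0 ≤ 2 * b by linarith)
  exact mul_le_one₀ h1 (by positivity) h2

theorem jacInt_mul_self_nonneg {a b : ℝ} (ha : 0 ≤ a) (hb : 0 ≤ b) (f : Polynomial ℝ) :
    0 ≤ jacInt ha hb (f * f) := by
  rw [jacInt_apply]
  refine intervalIntegral.integral_nonneg pi_pos.le fun θ _ => ?_
  rw [Polynomial.eval_mul]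
  exact mul_nonneg (mul_self_nonneg _) (circWeight_nonneg _ _ _)

theorem jacInt_mul_self_le {a b : ℝ} (ha : 0 ≤ a) (hb : 0 ≤ b) {f : Polynomial ℝ}
    (hf : ∀ φ : ℝ, |f.eval (cos φ)| ≤ 1) : jacInt ha hb (f * f) ≤ π := by
  have hw := continuous_circWeight ha hb
  rw [jacInt_apply]
  have : ∫ _ in (0 : ℝ)..π, (1 : ℝ) = π := by simp
  refine le_of_le_of_eq ?_ this
  have hcont : Continuous fun θ : ℝ => (f * f).eval (cos (2 * θ)) * circWeight a b θ := by fun_prop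
  refine intervalIntegral.integral_mono_on pi_pos.le (hcont.intervalIntegrable _ _)
    (continuous_const.intervalIntegrable _ _) fun θ _ => ?_
  rw [Polynomial.eval_mul]
  refine mul_le_one₀ ?_ (circWeight_nonneg _ _ _) (circWeight_le_one ha hb _)
  rw [← abs_mul_abs_self]
  exact mul_le_one₀ (hf _) (abs_nonneg _) (hf _)

open Polynomial in
theorem degree_jacPoly_sub_T_lt {a b : ℝ} {j : ℕ} (hj : 1 ≤ j) :
    (jacPoly a b j - Chebyshev.T ℝ (j : ℤ)).degree < j := by
  obtain ⟨R, rfl⟩ : ∃ R, j = R + 1 := ⟨j - 1, by omega⟩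
  rw [jacPoly, sum_range_succ', jacCoef_zero, one_smul, Nat.cast_zero, sub_zero]
  rw [show ∀ s t u : ℝ[X], s + t + u - t = s + u by intros; abel]
  · have hpos : (⊥ : WithBot ℕ) < ((R + 1 : ℕ) : WithBot ℕ) := WithBot.bot_lt_coe _
    refine (degree_add_le _ _).trans_lt (max_lt ?_ ?_)
    · refine (degree_sum_le _ _).trans_lt ?_
      rw [Finset.sup_lt_iff hpos]
      intro r hr
      refine (degree_smul_le _ _).trans_lt ?_
      rw [Chebyshev.degree_T]
      have := mem_range.1 hr
      exact_mod_cast (by omega : (((R + 1 : ℕ) : ℤ) - ((r + 1 : ℕ) : ℤ)).natAbs < R + 1)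
    · refine (degree_smul_le _ _).trans_lt ?_
      rw [degree_one]
      exact_mod_cast Nat.succ_pos R

open Polynomial in
theorem degree_jacPoly_le (a b : ℝ) (j : ℕ) : (jacPoly a b j).degree ≤ j := by
  rcases Nat.eq_zero_or_pos j with rfl | hj
  · simp only [jacPoly, range_zero, sum_empty, zero_add]
    exact (degree_smul_le _ _).trans degree_one_le
  · rw [← sub_add_cancel (jacPoly a b j) (Chebyshev.T ℝ (j : ℤ))]
    refine (degree_add_le _ _).trans (max_le (degree_jacPoly_sub_T_lt hj).le ?_)
    rw [Chebyshev.degree_T]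
    simp

open Polynomial in
theorem jacInt_jacPoly_mul_self_le {a b : ℝ} (hb : 0 ≤ b) (hab : b ≤ a) (j : ℕ) :
    jacInt (hb.trans hab) hb (jacPoly a b j * jacPoly a b j) ≤ π := by
  have ha := hb.trans hab
  rcases Nat.eq_zero_or_pos j with rfl | hj
  · refine jacInt_mul_self_le ha hb fun φ => ?_
    simp only [jacPoly, range_zero, sum_empty, zero_add, jacCoef_zero, eval_smul, eval_one]
    norm_num [abs_of_pos]
  set S := jacPoly a b j
  set T := Chebyshev.T ℝ (j : ℤ)
  have h1 : jacInt ha hb (S * (S - T)) = 0 := jacInt_jacPoly_mul hb hab (degree_jacPoly_sub_T_lt hj)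
  have h2 := jacInt_mul_self_nonneg ha hb (S - T)
  have h3 : T * T = S * S - (S * (S - T) + S * (S - T)) + (S - T) * (S - T) := by ring
  have h4 : jacInt ha hb (T * T) ≤ π := jacInt_mul_self_le ha hb fun φ => by
    rw [Chebyshev.T_real_cos]
    exact abs_cos_le_one _
  rw [h3, map_add, map_sub, map_add, h1] at h4
  linarith

open Polynomial in
theorem jacPoly_eval_one_ge {a b : ℝ} (hb : 0 ≤ b) (hab : b ≤ a) (j : ℕ) :
    (∑ r ∈ range (j + 1), jacCoef a b j r) / 2 ≤ (jacPoly a b j).eval 1 := by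
  have h := sum_nonneg fun r (hr : r ∈ range j) => jacCoef_nonneg (j := j) hb hab r
    (mem_range.1 hr).le
  rw [sum_range_succ]
  simp only [jacPoly, eval_add, eval_finsetSum, eval_smul, Chebyshev.T_eval_one, eval_one,
    smul_eq_mul, mul_one]
  linarith

theorem jacPoly_eval_one_pos {a b : ℝ} (hb : 0 ≤ b) (hab : b ≤ a) (j : ℕ) :
    0 < (jacPoly a b j).eval 1 := by
  refine lt_of_lt_of_le ?_ (jacPoly_eval_one_ge hb hab j)
  have h := single_le_sum (f := jacCoef a b j) (fun r (hr : r ∈ range (j + 1)) =>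
    jacCoef_nonneg hb hab r (Nat.lt_succ_iff.1 (mem_range.1 hr))) (mem_range.2 j.succ_pos)
  rw [jacCoef_zero] at h
  linarith

theorem exists_jacPoly_eval_one_ge {a b : ℝ} (hb : 0 ≤ b) (hab : b ≤ a) :
    ∃ c : ℝ, 0 < c ∧ ∀ j : ℕ, c * ((j : ℝ) + 1) ^ a ≤ (jacPoly a b j).eval 1 := by
  obtain ⟨c, hc, D, hD, h⟩ := exists_jacCoef_sum_ge hb hab
  have ha := hb.trans hab
  have hD0 : (0 : ℝ) < D := by exact_mod_cast (by omega : 0 < D)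
  refine ⟨c / D ^ a / 2, by positivity, fun j => ?_⟩
  refine le_trans ?_ (jacPoly_eval_one_ge hb hab j)
  have h1 := h j (j / D) (Nat.div_mul_le_self j D)
  have h2 : ∑ r ∈ range (j / D + 1), jacCoef a b j r ≤ ∑ r ∈ range (j + 1), jacCoef a b j r := by
    refine sum_le_sum_of_subset_of_nonneg (range_subset_range.2 ?_) fun r hr _ =>
      jacCoef_nonneg hb hab r (Nat.lt_succ_iff.1 (mem_range.1 hr))
    have := Nat.div_le_self j D
    omega
  have h3 : ((j : ℝ) + 1) / D ≤ ((j / D : ℕ) : ℝ) + 1 := by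
    rw [div_le_iff₀ hD0]
    have := Nat.lt_div_mul_add (a := j) (b := D) (by omega)
    have h4 : j + 1 ≤ (j / D + 1) * D := by rw [add_mul, one_mul]; omega
    exact_mod_cast h4
  have h4 : (((j : ℝ) + 1) / D) ^ a ≤ (((j / D : ℕ) : ℝ) + 1) ^ a :=
    rpow_le_rpow (by positivity) h3 ha
  rw [div_rpow (by positivity) hD0.le] at h4
  calc c / D ^ a / 2 * ((j : ℝ) + 1) ^ a = c * (((j : ℝ) + 1) ^ a / D ^ a) / 2 := by ring
    _ ≤ c * (((j / D : ℕ) : ℝ) + 1) ^ a / 2 := by gcongr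
    _ ≤ _ := by linarith

theorem integral_mul_wGG_eq (l m : ℝ) (F : ℝ → ℝ) :
    ∫ t in (-1 : ℝ)..1, F t * wGG l m t = ∫ θ in (0 : ℝ)..π, F (cos θ) * circWeight l m θ := by
  have himg : cos '' Set.Ioo 0 π = Set.Ioo (-1) 1 := by
    ext t
    constructor
    · rintro ⟨θ, ⟨h0, h1⟩, rfl⟩
      have hs := sin_pos_of_pos_of_lt_pi h0 h1
      have := sin_sq_add_cos_sq θ
      constructor <;> nlinarith
    · rintro ⟨h0, h1⟩
      exact ⟨arccos t, ⟨arccos_pos.2 h1, lt_of_le_of_ne (arccos_le_pi t)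
        fun h => absurd (arccos_eq_pi.1 h) (by linarith)⟩, cos_arccos h0.le h1.le⟩
  rw [intervalIntegral.integral_of_le (by norm_num), intervalIntegral.integral_of_le pi_pos.le,
    integral_Ioc_eq_integral_Ioo, integral_Ioc_eq_integral_Ioo, ← himg,
    integral_image_eq_integral_abs_deriv_smul measurableSet_Ioo
      (fun θ _ => (hasDerivAt_cos θ).hasDerivWithinAt)
      (injOn_cos.mono Set.Ioo_subset_Icc_self)]
  refine setIntegral_congr_fun measurableSet_Ioo fun θ hθ => ?_
  have hs := sin_pos_of_pos_of_lt_pi hθ.1 hθ.2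
  have h1 : sin θ * (1 - cos θ ^ 2) ^ (l - 1 / 2) = |sin θ| ^ (2 * l) := by
    rw [← sin_sq, ← rpow_natCast, ← rpow_mul hs.le, abs_of_pos hs]
    nth_rw 1 [← rpow_one (sin θ)]
    rw [← rpow_add hs]
    congr 1
    push_cast
    ring
  simp only [smul_eq_mul, abs_neg, wGG, circWeight]
  rw [← h1, abs_of_pos hs]
  ring

/-- Integration against the generalized Gegenbauer weight, written on the circle. -/
noncomputable def gegInt {l m : ℝ} (hl : 0 ≤ l) (hm : 0 ≤ m) : Polynomial ℝ →ₗ[ℝ] ℝ where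
  toFun f := ∫ θ in (0 : ℝ)..π, f.eval (cos θ) * circWeight l m θ
  map_add' f g := by
    have hw := continuous_circWeight hl hm
    rw [← intervalIntegral.integral_add]
    · refine intervalIntegral.integral_congr fun θ _ => ?_
      simp only [Polynomial.eval_add]
      ring
    all_goals exact Continuous.intervalIntegrable (by fun_prop) _ _
  map_smul' c f := by
    simp [mul_assoc]

theorem gegInt_apply {l m : ℝ} (hl : 0 ≤ l) (hm : 0 ≤ m) (f : Polynomial ℝ) :
    gegInt hl hm f = ∫ θ in (0 : ℝ)..π, f.eval (cos θ) * circWeight l m θ := rfl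

theorem integral_pi_sub (f : ℝ → ℝ) : ∫ θ in (0 : ℝ)..π, f (π - θ) = ∫ θ in (0 : ℝ)..π, f θ := by
  rw [intervalIntegral.integral_comp_sub_left (fun θ => f θ) π]
  simp

theorem circWeight_pi_sub (l m θ : ℝ) : circWeight l m (π - θ) = circWeight l m θ := by
  simp [circWeight, sin_pi_sub, cos_pi_sub]

theorem gegInt_comp_neg_X {l m : ℝ} (hl : 0 ≤ l) (hm : 0 ≤ m) (f : Polynomial ℝ) :
    gegInt hl hm (f.comp (-Polynomial.X)) = gegInt hl hm f := by
  rw [gegInt_apply, gegInt_apply, ← integral_pi_sub fun θ => f.eval (cos θ) * circWeight l m θ]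
  simp [cos_pi_sub, circWeight_pi_sub]

section Orthonormal

open Polynomial

variable {p : ℕ → ℝ[X]} {L : ℝ[X] →ₗ[ℝ] ℝ}

theorem exists_sum_C_mul_of_degree_lt (hdeg : ∀ k, (p k).degree = k) (n : ℕ) :
    ∀ f : ℝ[X], f.degree < n → ∃ d : ℕ → ℝ, f = ∑ i ∈ range n, C (d i) * p i := by
  induction n with
  | zero => exact fun f hf => ⟨0, by simpa using hf⟩
  | succ n ih =>
    intro f hf
    have hpn : (p n).coeff n ≠ 0 := coeff_ne_zero_of_eq_degree (hdeg n)
    obtain ⟨d, hd⟩ := ih (f - C (f.coeff n / (p n).coeff n) * p n) (by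
      rw [degree_lt_iff_coeff_zero]
      intro i hi
      rcases hi.eq_or_lt with rfl | hi
      · rw [coeff_sub, coeff_C_mul]
        field_simp
        simp
      · rw [coeff_sub, coeff_C_mul, coeff_eq_zero_of_degree_lt (hf.trans_le (by exact_mod_cast hi)),
          coeff_eq_zero_of_degree_lt (n := i) (p := p n) (by rw [hdeg]; exact_mod_cast hi)]
        simp)
    refine ⟨fun i => if i = n then f.coeff n / (p n).coeff n else d i, ?_⟩
    rw [sum_range_succ]
    refine (sub_eq_iff_eq_add.1 hd).trans ?_
    congr 1
    · refine sum_congr rfl fun i hi => ?_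
      simp only [if_neg (mem_range.1 hi).ne]
    · simp only [if_true]

theorem orthonormal_apply_mul_eq_zero (hdeg : ∀ k, (p k).degree = k)
    (horth : ∀ j k, L (p j * p k) = if j = k then 1 else 0) {k : ℕ} {f : ℝ[X]}
    (hf : f.degree < k) : L (p k * f) = 0 := by
  obtain ⟨d, rfl⟩ := exists_sum_C_mul_of_degree_lt hdeg k f hf
  rw [mul_sum, map_sum]
  refine sum_eq_zero fun i hi => ?_
  rw [← smul_eq_C_mul, mul_smul_comm, map_smul, horth, if_neg (mem_range.1 hi).ne', smul_zero]

theorem eq_C_mul_of_orthogonal (hdeg : ∀ k, (p k).degree = k)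
    (horth : ∀ j k, L (p j * p k) = if j = k then 1 else 0) {k : ℕ} {S : ℝ[X]}
    (hS : S.degree ≤ k) (h : ∀ f : ℝ[X], f.degree < k → L (S * f) = 0) :
    ∃ c : ℝ, S = C c * p k := by
  obtain ⟨d, hd⟩ := exists_sum_C_mul_of_degree_lt hdeg (k + 1) S
    (hS.trans_lt (by exact_mod_cast k.lt_succ_self))
  refine ⟨d k, ?_⟩
  have h0 : ∀ i < k, d i = 0 := by
    intro i hi
    have h1 := h (p i) (by rw [hdeg]; exact_mod_cast hi)
    rw [hd, sum_mul, map_sum] at h1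
    simp only [← smul_eq_C_mul, smul_mul_assoc, map_smul, horth, smul_eq_mul, mul_ite, mul_one,
      mul_zero] at h1
    rwa [sum_ite_eq' (range (k + 1)) i d, if_pos (mem_range.2 (by omega))] at h1
  rw [hd, sum_range_succ, sum_eq_zero fun i hi => by rw [h0 i (mem_range.1 hi)]; simp, zero_add]

theorem orthonormal_comp_neg_X_of_odd (hdeg : ∀ k, (p k).degree = k)
    (horth : ∀ j k, L (p j * p k) = if j = k then 1 else 0)
    (hL : ∀ f : ℝ[X], L (f.comp (-X)) = L f) {k : ℕ} (hk : Odd k) : (p k).comp (-X) = -p k := by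
  have hnat : ∀ f : ℝ[X], (f.comp (-X)).natDegree = f.natDegree := fun f => by
    rw [natDegree_comp, natDegree_neg, natDegree_X, mul_one]
  have hdegc : ∀ f : ℝ[X], (f.comp (-X)).degree = f.degree := fun f => by
    rcases eq_or_ne f 0 with rfl | hf
    · simp
    rw [degree_eq_natDegree hf, degree_eq_natDegree, hnat]
    intro h
    have := comp_eq_zero_iff.1 h
    rcases this with h | h
    · exact hf h
    · have := congrArg natDegree h.2
      rw [natDegree_neg, natDegree_X, natDegree_C] at this
      exact one_ne_zero this
  obtain ⟨c, hc⟩ := eq_C_mul_of_orthogonal hdeg horth (k := k) (S := (p k).comp (-X))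
    (by rw [hdegc, hdeg]) (fun f hf => by
      have h1 : (p k).comp (-X) * f = (p k * f.comp (-X)).comp (-X) := by
        rw [mul_comp, comp_assoc f]
        simp
      rw [h1, hL]
      exact orthonormal_apply_mul_eq_zero hdeg horth (by rwa [hdegc]))
  have hlc := congrArg leadingCoeff hc
  have hpk : p k ≠ 0 := fun h => by
    have := hdeg k
    rw [h, degree_zero] at this
    exact absurd this.symm (WithBot.coe_ne_bot)
  rw [leadingCoeff_comp (by rw [natDegree_neg, natDegree_X]; exact one_ne_zero), leadingCoeff_mul,
    leadingCoeff_C, leadingCoeff_neg, leadingCoeff_X, natDegree_eq_of_degree_eq_some (hdeg k),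
    hk.neg_one_pow, mul_comm] at hlc
  have := mul_right_cancel₀ (leadingCoeff_ne_zero.2 hpk) hlc
  rw [hc, ← this]
  simp

end Orthonormal

theorem sum_integral_mul_le_TGG {l m : ℝ} (hl : 0 ≤ l) (hm : 0 ≤ m) (p : ℕ → Polynomial ℝ)
    (δ : ℝ) (n : ℕ) (t : ℝ) {g : ℝ → ℝ} (hg : Continuous g) {C : ℝ}
    (hgC : ∀ θ, |g θ| ≤ C * circWeight l m θ) :
    (cesA δ n)⁻¹ * ∑ k ∈ range (n + 1),
      cesA δ (n - k) * (p k).eval t * ∫ θ in (0 : ℝ)..π, (p k).eval (cos θ) * g θ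
      ≤ C * TGG p l m δ n t := by
  have hw := continuous_circWeight hl hm
  have hK : Continuous fun s => cesKer p δ n s t := by
    unfold cesKer
    fun_prop
  have h1 : TGG p l m δ n t = ∫ θ in (0 : ℝ)..π, |cesKer p δ n (cos θ) t| * circWeight l m θ :=
    integral_mul_wGG_eq l m fun s => |cesKer p δ n s t|
  have h2 : (cesA δ n)⁻¹ * ∑ k ∈ range (n + 1),
      cesA δ (n - k) * (p k).eval t * ∫ θ in (0 : ℝ)..π, (p k).eval (cos θ) * g θ
      = ∫ θ in (0 : ℝ)..π, cesKer p δ n (cos θ) t * g θ := by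
    simp only [← intervalIntegral.integral_const_mul]
    rw [← intervalIntegral.integral_finsetSum, ← intervalIntegral.integral_const_mul]
    · refine intervalIntegral.integral_congr fun θ _ => ?_
      simp only [cesKer, mul_sum, sum_mul]
      exact sum_congr rfl fun k _ => by ring
    · intro k _
      exact Continuous.intervalIntegrable (by fun_prop) _ _
  rw [h1, h2, ← intervalIntegral.integral_const_mul]
  have c1 : Continuous fun θ => cesKer p δ n (cos θ) t * g θ := by fun_prop
  have c2 : Continuous fun θ => C * (|cesKer p δ n (cos θ) t| * circWeight l m θ) := by fun_prop
  refine intervalIntegral.integral_mono_on pi_pos.le (c1.intervalIntegrable _ _)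
    (c2.intervalIntegrable _ _) fun θ _ => ?_
  calc cesKer p δ n (cos θ) t * g θ ≤ |cesKer p δ n (cos θ) t * g θ| := le_abs_self _
    _ = |cesKer p δ n (cos θ) t| * |g θ| := abs_mul _ _
    _ ≤ |cesKer p δ n (cos θ) t| * (C * circWeight l m θ) := by gcongr; exact hgC θ
    _ = _ := by ring

theorem gegInt_orthonormal {l m : ℝ} (hl : 0 ≤ l) (hm : 0 ≤ m) {p : ℕ → Polynomial ℝ}
    (h : ∀ j k, (∫ t in (-1 : ℝ)..1, (p j).eval t * (p k).eval t * wGG l m t)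
      = if j = k then 1 else 0) (j k : ℕ) :
    gegInt hl hm (p j * p k) = if j = k then 1 else 0 := by
  rw [← h, integral_mul_wGG_eq l m fun t => (p j).eval t * (p k).eval t, gegInt_apply]
  simp

open Polynomial in
theorem one_le_TGG {l m : ℝ} (hl : 0 ≤ l) (hm : 0 ≤ m) {p : ℕ → Polynomial ℝ}
    (hdeg : ∀ k, (p k).degree = k)
    (horth : ∀ j k, gegInt hl hm (p j * p k) = if j = k then 1 else 0)
    {δ : ℝ} (hδ : -1 < δ) (n : ℕ) (t : ℝ) : 1 ≤ TGG p l m δ n t := by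
  have h := sum_integral_mul_le_TGG hl hm p δ n t (continuous_circWeight hl hm) (C := 1)
    (fun θ => by rw [abs_of_nonneg (circWeight_nonneg _ _ _), one_mul])
  rw [one_mul] at h
  refine le_trans (le_of_eq ?_) h
  simp only [← gegInt_apply hl hm]
  have h0 : p 0 = C ((p 0).coeff 0) := eq_C_of_degree_le_zero (by rw [hdeg]; simp)
  rw [sum_range_succ', sum_eq_zero]
  · have h1 := horth 0 0
    rw [if_pos rfl] at h1
    have h2 : (p 0).eval t * gegInt hl hm (p 0) = 1 := by
      rw [← h1]
      nth_rw 3 [h0]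
      rw [← smul_eq_C_mul, map_smul, h0]
      simp
    rw [zero_add, Nat.sub_zero, mul_assoc, h2, mul_one, inv_mul_cancel₀ (cesA_pos hδ n).ne']
  · intro k _
    have h1 := orthonormal_apply_mul_eq_zero hdeg horth (k := k + 1) (f := 1)
      (by rw [degree_one]; exact_mod_cast k.succ_pos)
    rw [mul_one] at h1
    rw [h1, mul_zero]

theorem sum_range_eq_sum_even {f : ℕ → ℝ} (hf : ∀ k, Odd k → f k = 0) (n : ℕ) :
    ∑ k ∈ range (n + 1), f k = ∑ j ∈ range (n / 2 + 1), f (2 * j) := by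
  induction n with
  | zero => simp
  | succ n ih =>
    rw [sum_range_succ, ih]
    rcases Nat.even_or_odd (n + 1) with h | h
    · obtain ⟨r, hr⟩ := h
      rw [show (n + 1) / 2 = n / 2 + 1 by omega, sum_range_succ _ (n / 2 + 1)]
      congr 2
      omega
    · rw [hf _ h, add_zero]
      obtain ⟨r, hr⟩ := h
      rw [show (n + 1) / 2 = n / 2 by omega]

section QuadraticTransform

open Polynomial

variable {l m a b : ℝ} (hl : 0 ≤ l) (hm : 0 ≤ m) (hb : 0 ≤ b) (hab : b ≤ a) {ε : ℝ}

theorem exists_jacPoly_comp_eq (hε : ε * ε = 1)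
    (hJ : ∀ f : ℝ[X], ∫ θ in (0 : ℝ)..π, f.eval (ε * cos (2 * θ)) * circWeight l m θ
      = jacInt (hb.trans hab) hb f)
    {p : ℕ → ℝ[X]} (hdeg : ∀ k, (p k).degree = k)
    (horth : ∀ j k, gegInt hl hm (p j * p k) = if j = k then 1 else 0) (j : ℕ) :
    ∃ c : ℝ, (jacPoly a b j).comp (C ε * (2 * X ^ 2 - 1)) = C c * p (2 * j) ∧
      jacInt (hb.trans hab) hb (jacPoly a b j * jacPoly a b j) = c ^ 2 := by
  set Y : ℝ[X] := C ε * (2 * X ^ 2 - 1) with hY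
  set L := gegInt hl hm
  have hLY : ∀ f : ℝ[X], L (f.comp Y) = jacInt (hb.trans hab) hb f := by
    intro f
    rw [← hJ]
    refine intervalIntegral.integral_congr fun θ _ => ?_
    simp [hY, eval_comp, cos_two_mul]
  have hYn : Y.natDegree ≤ 2 := by
    rw [hY]
    compute_degree
  have hYneg : Y.comp (-X) = Y := by
    rw [hY]
    simp
  obtain ⟨c, hc⟩ := eq_C_mul_of_orthogonal (L := L) hdeg horth (k := 2 * j)
    (S := (jacPoly a b j).comp Y) (by
      refine degree_le_natDegree.trans ?_
      have h1 := natDegree_comp_le (p := jacPoly a b j) (q := Y)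
      have h2 : (jacPoly a b j).natDegree ≤ j := natDegree_le_of_degree_le (degree_jacPoly_le a b j)
      have h3 := Nat.mul_le_mul h2 hYn
      exact_mod_cast (by omega : ((jacPoly a b j).comp Y).natDegree ≤ 2 * j))
    (by
      intro f hf
      have hX : ∀ i < 2 * j, L ((jacPoly a b j).comp Y * X ^ i) = 0 := by
        intro i hi
        rcases Nat.even_or_odd i with ⟨r, hr⟩ | hodd
        · have h1 : (X : ℝ[X]) ^ i = ((C (1 / 2) * (1 + C ε * X)) ^ r).comp Y := by
            rw [pow_comp, hr, ← two_mul, pow_mul]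
            congr 1
            simp only [mul_comp, add_comp, C_comp, one_comp, X_comp, hY]
            have h2 : (C ε : ℝ[X]) * C ε = 1 := by rw [← C_mul, hε, C_1]
            have h3 : (C (1 / 2) : ℝ[X]) * 2 = 1 := by
              rw [show (2 : ℝ[X]) = C 2 from rfl, ← C_mul]
              norm_num
            linear_combination (-(C (1 / 2) * (2 * X ^ 2 - 1))) * h2 - X ^ 2 * h3
          rw [h1, ← mul_comp, hLY]
          refine jacInt_jacPoly_mul hb hab ?_
          refine lt_of_le_of_lt (degree_pow_le_of_le (a := 1) r ?_) ?_
          · compute_degree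
          · rw [mul_one]
            exact_mod_cast (by omega : r < j)
        · have h1 := gegInt_comp_neg_X hl hm ((jacPoly a b j).comp Y * X ^ i)
          rw [mul_comp, comp_assoc, hYneg, X_pow_comp, hodd.neg_pow, mul_neg, map_neg] at h1
          change -(L _) = L _ at h1
          linarith
      rcases Nat.eq_zero_or_pos j with rfl | hj
      · have : f = 0 := by simpa using hf
        simp [this]
      have hf' : f.natDegree < 2 * j := by
        rcases eq_or_ne f 0 with rfl | h0
        · rw [natDegree_zero]; omega
        · exact (natDegree_lt_iff_degree_lt h0).2 hf
      rw [as_sum_range' f (2 * j) hf', mul_sum, map_sum]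
      refine sum_eq_zero fun i hi => ?_
      rw [← C_mul_X_pow_eq_monomial, ← smul_eq_C_mul, mul_smul_comm, map_smul,
        hX i (mem_range.1 hi), smul_zero])
  refine ⟨c, hc, ?_⟩
  rw [← hLY, mul_comp, hc, show C c * p (2 * j) * (C c * p (2 * j))
    = c ^ 2 • (p (2 * j) * p (2 * j)) by rw [smul_eq_C_mul, C_pow]; ring, map_smul, horth,
    if_pos rfl, smul_eq_mul, mul_one]

theorem sum_jacPoly_integral_le_TGG (hε : ε * ε = 1)
    (hJ : ∀ f : ℝ[X], ∫ θ in (0 : ℝ)..π, f.eval (ε * cos (2 * θ)) * circWeight l m θ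
      = jacInt (hb.trans hab) hb f)
    {p : ℕ → ℝ[X]} (hdeg : ∀ k, (p k).degree = k)
    (horth : ∀ j k, gegInt hl hm (p j * p k) = if j = k then 1 else 0)
    {t : ℝ} (ht : ε * (2 * t ^ 2 - 1) = 1) {δ : ℝ} (hδ : -1 < δ) (n : ℕ)
    {g : ℝ → ℝ} (hg : Continuous g) (hgs : ∀ θ, g (π - θ) = g θ) {B : ℝ}
    (hgB : ∀ θ, |g θ| ≤ B * circWeight l m θ)
    (hpos : ∀ j ≤ n / 2, 0 ≤ ∫ θ in (0 : ℝ)..π, (jacPoly a b j).eval (ε * cos (2 * θ)) * g θ) :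
    (cesA δ n)⁻¹ * ∑ j ∈ range (n / 2 + 1), cesA δ (n - 2 * j) * (jacPoly a b j).eval 1 *
      ∫ θ in (0 : ℝ)..π, (jacPoly a b j).eval (ε * cos (2 * θ)) * g θ
      ≤ π * B * TGG p l m δ n t := by
  have h := sum_integral_mul_le_TGG hl hm p δ n t hg hgB
  rw [sum_range_eq_sum_even] at h
  · rw [mul_assoc]
    refine le_trans ?_ (mul_le_mul_of_nonneg_left h pi_pos.le)
    rw [mul_left_comm]
    refine mul_le_mul_of_nonneg_left ?_ (inv_nonneg.2 (cesA_pos hδ n).le)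
    rw [mul_sum]
    refine sum_le_sum fun j hj => ?_
    obtain ⟨c, hc, hc2⟩ := exists_jacPoly_comp_eq hl hm hb hab hε hJ hdeg horth j
    have hev : ∀ s, (jacPoly a b j).eval (ε * (2 * s ^ 2 - 1)) = c * (p (2 * j)).eval s := by
      intro s
      have := congrArg (Polynomial.eval s) hc
      simpa [eval_comp] using this
    have hpt := hev t
    rw [ht] at hpt
    have hcpi : c ^ 2 ≤ π := hc2 ▸ jacInt_jacPoly_mul_self_le hb hab j
    have hI : ∫ θ in (0 : ℝ)..π, (jacPoly a b j).eval (ε * cos (2 * θ)) * g θ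
        = c * ∫ θ in (0 : ℝ)..π, (p (2 * j)).eval (cos θ) * g θ := by
      rw [← intervalIntegral.integral_const_mul]
      refine intervalIntegral.integral_congr fun θ _ => ?_
      simp only [cos_two_mul, hev, mul_assoc]
    have hj0 := hpos j (Nat.lt_succ_iff.1 (mem_range.1 hj))
    have hS := jacPoly_eval_one_pos hb hab j
    have hc0 : c ≠ 0 := by
      rintro rfl
      rw [zero_mul] at hpt
      exact hS.ne' hpt
    have hA := (cesA_pos hδ (n - 2 * j)).le
    have hc2pos : 0 < c ^ 2 := by positivity
    set I := ∫ θ in (0 : ℝ)..π, (jacPoly a b j).eval (ε * cos (2 * θ)) * g θ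
    set I' := ∫ θ in (0 : ℝ)..π, (p (2 * j)).eval (cos θ) * g θ
    have h5 : (p (2 * j)).eval t * I' * c ^ 2 = (jacPoly a b j).eval 1 * I := by
      rw [hpt, hI]; ring
    have h6 : 0 ≤ (p (2 * j)).eval t * I' := by
      by_contra hneg
      push Not at hneg
      have := mul_neg_of_neg_of_pos hneg hc2pos
      rw [h5] at this
      exact absurd this (not_lt.2 (mul_nonneg hS.le hj0))
    calc cesA δ (n - 2 * j) * (jacPoly a b j).eval 1 * I
        = cesA δ (n - 2 * j) * ((p (2 * j)).eval t * I' * c ^ 2) := by rw [h5]; ring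
      _ ≤ cesA δ (n - 2 * j) * ((p (2 * j)).eval t * I' * π) := by gcongr
      _ = _ := by ring
  · intro k hk
    have h1 := orthonormal_comp_neg_X_of_odd hdeg horth (gegInt_comp_neg_X hl hm) hk
    have h2 : ∀ s, (p k).eval (-s) = -(p k).eval s := by
      intro s
      have := congrArg (Polynomial.eval s) h1
      simpa [eval_comp] using this
    have h3 := integral_pi_sub fun θ => (p k).eval (cos θ) * g θ
    simp only [cos_pi_sub, h2, hgs, neg_mul, intervalIntegral.integral_neg] at h3
    have h4 : ∫ θ in (0 : ℝ)..π, (p k).eval (cos θ) * g θ = 0 := by linarith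
    rw [h4, mul_zero]

end QuadraticTransform

section TestPolynomial

open Polynomial

/-- A polynomial whose first `m` coefficients are at least `1`, and which is small near `±1`. -/
noncomputable def testPoly (P m : ℕ) : ℝ[X] :=
  (1 - X ^ m) ^ P * ((1 + X) ^ P * ∑ i ∈ range m, X ^ i)

theorem one_le_coeff_testPoly (P : ℕ) {m i : ℕ} (hi : i < m) : 1 ≤ (testPoly P m).coeff i := by
  have hgeom : ∀ k, (∑ i ∈ range m, (X : ℝ[X]) ^ i).coeff k = if k < m then 1 else 0 := by
    intro k
    simp [coeff_X_pow]
  have h1 : 1 ≤ ((1 + X) ^ P * ∑ i ∈ range m, X ^ i : ℝ[X]).coeff i := by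
    rw [coeff_mul]
    have h := single_le_sum (f := fun x : ℕ × ℕ => ((1 + X : ℝ[X]) ^ P).coeff x.1
      * (∑ i ∈ range m, (X : ℝ[X]) ^ i).coeff x.2) (s := antidiagonal i) (a := (0, i))
      (fun x _ => by
        rw [hgeom, coeff_one_add_X_pow]
        split_ifs <;> simp) (by simp)
    refine le_trans (le_of_eq ?_) h
    simp [hgeom, hi, coeff_one_add_X_pow]
  obtain ⟨Q, hQ⟩ := sub_dvd_pow_sub_pow (1 - X ^ m : ℝ[X]) 1 P
  have h2 : testPoly P m = (1 + X) ^ P * ∑ i ∈ range m, X ^ i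
      + X ^ m * (-Q * ((1 + X) ^ P * ∑ i ∈ range m, X ^ i)) := by
    rw [one_pow] at hQ
    rw [testPoly, sub_eq_iff_eq_add.1 hQ]
    ring
  rw [h2, coeff_add, coeff_X_pow_mul', if_neg (by omega), add_zero]
  exact h1

/-- The real part of `z ^ s * testPoly P m z` at `z = exp (i φ)`. -/
noncomputable def trigTest (P m s : ℕ) (φ : ℝ) : ℝ :=
  ∑ i ∈ range ((testPoly P m).natDegree + 1), (testPoly P m).coeff i * cos ((s + i : ℕ) * φ)

theorem trigTest_eq_re (P m s : ℕ) (φ : ℝ) :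
    trigTest P m s φ
      = (Complex.exp (φ * Complex.I) ^ s
        * aeval (Complex.exp (φ * Complex.I)) (testPoly P m)).re := by
  rw [aeval_eq_sum_range, mul_sum, Complex.re_sum, trigTest]
  refine sum_congr rfl fun i _ => ?_
  rw [mul_smul_comm, ← pow_add, Complex.smul_re, smul_eq_mul, ← Complex.exp_nat_mul,
    ← Complex.exp_ofReal_mul_I_re]
  congr 3
  push_cast
  ring

theorem abs_trigTest_le (P m s : ℕ) (φ : ℝ) :
    |trigTest P m s φ| ≤ ‖aeval (Complex.exp (φ * Complex.I)) (testPoly P m)‖ := by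
  rw [trigTest_eq_re]
  refine (Complex.abs_re_le_norm _).trans ?_
  rw [norm_mul, norm_pow, Complex.norm_exp_ofReal_mul_I, one_pow, one_mul]

theorem norm_aeval_testPoly (P m : ℕ) (z : ℂ) :
    ‖aeval z (testPoly P m)‖ = ‖1 - z ^ m‖ ^ P * (‖1 + z‖ ^ P * ‖∑ i ∈ range m, z ^ i‖) := by
  simp [testPoly]

end TestPolynomial

theorem norm_one_sub_exp (θ : ℝ) : ‖1 - Complex.exp ((2 * θ : ℝ) * Complex.I)‖ = 2 * |sin θ| := by
  rw [← abs_of_nonneg (norm_nonneg _), ← abs_two, ← abs_mul, ← sq_eq_sq_iff_abs_eq_abs,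
    ← Complex.normSq_eq_norm_sq, Complex.normSq_apply]
  simp only [Complex.sub_re, Complex.sub_im, Complex.exp_ofReal_mul_I_re,
    Complex.exp_ofReal_mul_I_im, Complex.one_re, Complex.one_im, abs_two]
  rw [cos_two_mul, sin_two_mul]
  linear_combination 4 * cos θ ^ 2 * sin_sq_add_cos_sq θ - 4 * sin_sq_add_cos_sq θ

theorem norm_one_add_exp (θ : ℝ) : ‖1 + Complex.exp ((2 * θ : ℝ) * Complex.I)‖ = 2 * |cos θ| := by
  rw [← abs_of_nonneg (norm_nonneg _), ← abs_two, ← abs_mul, ← sq_eq_sq_iff_abs_eq_abs,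
    ← Complex.normSq_eq_norm_sq, Complex.normSq_apply]
  simp only [Complex.add_re, Complex.add_im, Complex.exp_ofReal_mul_I_re,
    Complex.exp_ofReal_mul_I_im, Complex.one_re, Complex.one_im, abs_two]
  rw [cos_two_mul, sin_two_mul]
  linear_combination 4 * cos θ ^ 2 * sin_sq_add_cos_sq θ

theorem norm_geom_sum_le {z : ℂ} (hz : ‖z‖ = 1) (m : ℕ) : ‖∑ i ∈ range m, z ^ i‖ ≤ m := by
  refine (norm_sum_le _ _).trans ?_
  simp [hz]

theorem norm_one_sub_pow_le_mul {z : ℂ} (hz : ‖z‖ = 1) (m : ℕ) : ‖1 - z ^ m‖ ≤ m * ‖1 - z‖ := by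
  rw [← mul_neg_geom_sum, norm_mul, mul_comm]
  exact mul_le_mul_of_nonneg_right (norm_geom_sum_le hz m) (norm_nonneg _)

theorem norm_one_sub_pow_le_two {z : ℂ} (hz : ‖z‖ = 1) (m : ℕ) : ‖1 - z ^ m‖ ≤ 2 := by
  refine (norm_sub_le _ _).trans ?_
  rw [norm_one, norm_pow, hz, one_pow]
  norm_num

theorem sum_div_rpow_le {a y : ℝ} (ha : 0 ≤ a) (hy : 0 < y) {P : ℕ} (hP : 2 * a + 1 ≤ P)
    {v : ℕ → ℝ} (hv1 : ∀ m : ℕ, v m ≤ (m * y) ^ P * m) (hv2 : ∀ m, v m ≤ 2 ^ (P + 1) / y)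
    (M : ℕ) :
    ∑ m ∈ Icc 1 M, v m / (m : ℝ) ^ (2 * a + 2) ≤ (1 + 2 ^ (P + 2)) * y ^ (2 * a) := by
  set K := ⌊1 / y⌋₊ with hK
  have hKle : (K : ℝ) ≤ 1 / y := Nat.floor_le (by positivity)
  have hKlt : 1 / y < K + 1 := Nat.lt_floor_add_one _
  rw [add_mul, one_mul, ← sum_filter_add_sum_filter_not (Icc 1 M) (fun m => m ≤ K)]
  refine add_le_add ?_ ?_
  · have h1 : ∀ m ∈ (Icc 1 M).filter (fun m => m ≤ K),
        v m / (m : ℝ) ^ (2 * a + 2) ≤ y ^ (2 * a + 1) := by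
      intro m hm
      simp only [mem_filter, mem_Icc] at hm
      have hm0 : (0 : ℝ) < m := by exact_mod_cast hm.1.1
      have hmy : m * y ≤ 1 := by
        rw [← le_div_iff₀ hy]
        exact le_trans (by exact_mod_cast hm.2) hKle
      have h2 : (m * y) ^ P ≤ (m : ℝ) ^ (2 * a + 1) * y ^ (2 * a + 1) := by
        rw [← mul_rpow hm0.le hy.le, ← rpow_natCast]
        exact rpow_le_rpow_of_exponent_ge (by positivity) hmy hP
      rw [div_le_iff₀ (by positivity), show 2 * a + 2 = (2 * a + 1) + 1 by ring,
        rpow_add_one hm0.ne']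
      calc v m ≤ (m * y) ^ P * m := hv1 m
        _ ≤ (m : ℝ) ^ (2 * a + 1) * y ^ (2 * a + 1) * m := by gcongr
        _ = _ := by ring
    refine (sum_le_card_nsmul _ _ _ h1).trans ?_
    have h2 : ((Icc 1 M).filter (fun m => m ≤ K)).card ≤ K := by
      have : (Icc 1 M).filter (fun m => m ≤ K) ⊆ Icc 1 K := by
        intro m hm
        simp only [mem_filter, mem_Icc] at hm ⊢
        exact ⟨hm.1.1, hm.2⟩
      simpa using card_le_card this
    rw [nsmul_eq_mul, rpow_add_one hy.ne']
    have h3 : (((Icc 1 M).filter (fun m => m ≤ K)).card : ℝ) * y ≤ 1 := by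
      rw [← le_div_iff₀ hy]
      exact le_trans (by exact_mod_cast h2) hKle
    have h4 : 0 < y ^ (2 * a) := by positivity
    nlinarith
  · have h1 : ∀ m ∈ (Icc 1 M).filter (fun m => ¬ m ≤ K),
        v m / (m : ℝ) ^ (2 * a + 2) ≤ 2 ^ (P + 1) / y * y ^ (2 * a) * ((m : ℝ) ^ 2)⁻¹ := by
      intro m hm
      simp only [mem_filter, mem_Icc, not_le] at hm
      have hm0 : (0 : ℝ) < m := by exact_mod_cast hm.1.1
      have hmy : 1 ≤ m * y := by
        rw [← div_le_iff₀ hy]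
        have : (K : ℝ) + 1 ≤ m := by exact_mod_cast hm.2
        linarith
      have h2 : 1 ≤ (m : ℝ) ^ (2 * a) * y ^ (2 * a) := by
        rw [← mul_rpow hm0.le hy.le]
        exact one_le_rpow hmy (by positivity)
      rw [div_le_iff₀ (by positivity), rpow_add hm0, rpow_two]
      have h3 : 0 ≤ 2 ^ (P + 1) / y := by positivity
      calc v m ≤ 2 ^ (P + 1) / y * 1 := by rw [mul_one]; exact hv2 m
        _ ≤ 2 ^ (P + 1) / y * ((m : ℝ) ^ (2 * a) * y ^ (2 * a)) := by gcongr
        _ = _ := by field_simp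
    refine (sum_le_sum h1).trans ?_
    rw [← mul_sum]
    have h2 : ∑ m ∈ (Icc 1 M).filter (fun m => ¬ m ≤ K), ((m : ℝ) ^ 2)⁻¹ ≤ 2 * y := by
      have hsub : (Icc 1 M).filter (fun m => ¬ m ≤ K) ⊆ Ioo K (M + 1) := by
        intro m hm
        simp only [mem_filter, mem_Icc, mem_Ioo] at hm ⊢
        omega
      refine (sum_le_sum_of_subset_of_nonneg hsub fun _ _ _ => by positivity).trans ?_
      refine (sum_Ioo_inv_sq_le K (M + 1)).trans ?_
      rw [div_le_iff₀ (by positivity)]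
      rw [div_lt_iff₀ hy] at hKlt
      nlinarith
    have h3 : 0 ≤ 2 ^ (P + 1) / y * y ^ (2 * a) := by positivity
    calc _ ≤ 2 ^ (P + 1) / y * y ^ (2 * a) * (2 * y) := by gcongr
      _ = 2 ^ (P + 2) * y ^ (2 * a) := by field_simp; ring

/-- The test function obtained by averaging `trigTest` over the scales up to `M`. -/
noncomputable def testFun (a : ℝ) (P N M : ℕ) (φ : ℝ) : ℝ :=
  ∑ m ∈ Icc 1 M, trigTest P m (N - m + 1) φ / (m : ℝ) ^ (2 * a + 2)

theorem continuous_testFun (a : ℝ) (P N M : ℕ) : Continuous (testFun a P N M) := by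
  unfold testFun trigTest
  fun_prop

theorem testFun_neg (a : ℝ) (P N M : ℕ) (φ : ℝ) : testFun a P N M (-φ) = testFun a P N M φ := by
  simp [testFun, trigTest]

theorem testFun_add_two_pi (a : ℝ) (P N M : ℕ) (φ : ℝ) :
    testFun a P N M (φ + 2 * π) = testFun a P N M φ := by
  unfold testFun trigTest
  simp only [mul_add, cos_add_nat_mul_two_pi]

theorem abs_testFun_le {a b : ℝ} (hb : 0 ≤ b) (hab : b ≤ a) {P : ℕ} (hP : 2 * a + 1 ≤ P)
    (N M : ℕ) (θ : ℝ) :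
    |testFun a P N M (2 * θ)|
      ≤ 2 ^ P * ((1 + 2 ^ (P + 2)) * 2 ^ (2 * a)) * circWeight a b θ := by
  have ha := hb.trans hab
  set z := Complex.exp ((2 * θ : ℝ) * Complex.I) with hz
  have hz1 : ‖z‖ = 1 := Complex.norm_exp_ofReal_mul_I _
  have hP0 : P ≠ 0 := by
    rintro rfl
    norm_num at hP
    linarith
  have h1 : |testFun a P N M (2 * θ)| ≤ ∑ m ∈ Icc 1 M, ‖1 + z‖ ^ P *
      (‖1 - z ^ m‖ ^ P * ‖∑ i ∈ range m, z ^ i‖ / (m : ℝ) ^ (2 * a + 2)) := by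
    refine (abs_sum_le_sum_abs _ _).trans (sum_le_sum fun m _ => ?_)
    rw [abs_div, abs_of_nonneg (show (0 : ℝ) ≤ (m : ℝ) ^ (2 * a + 2) by positivity),
      ← mul_div_assoc]
    refine div_le_div_of_nonneg_right ?_ (by positivity)
    refine (abs_trigTest_le _ _ _ _).trans (le_of_eq ?_)
    rw [norm_aeval_testPoly]
    ring
  refine h1.trans ?_
  rw [← mul_sum]
  have hy : ‖1 - z‖ = 2 * |sin θ| := norm_one_sub_exp θ
  have hx : ‖1 + z‖ = 2 * |cos θ| := norm_one_add_exp θ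
  have h2 : ∑ m ∈ Icc 1 M, ‖1 - z ^ m‖ ^ P * ‖∑ i ∈ range m, z ^ i‖ / (m : ℝ) ^ (2 * a + 2)
      ≤ (1 + 2 ^ (P + 2)) * ‖1 - z‖ ^ (2 * a) := by
    rcases (norm_nonneg (1 - z)).eq_or_lt with h0 | hpos
    · rw [sum_eq_zero]
      · positivity
      · intro m _
        have : z = 1 := (sub_eq_zero.1 (norm_eq_zero.1 h0.symm)).symm
        simp [this, hP0]
    · refine sum_div_rpow_le ha hpos hP (fun m => ?_) (fun m => ?_) M
      · gcongr
        · exact norm_one_sub_pow_le_mul hz1 m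
        · exact norm_geom_sum_le hz1 m
      · rw [le_div_iff₀ hpos, mul_assoc, ← norm_mul, geom_sum_mul_neg, ← pow_succ]
        gcongr
        exact norm_one_sub_pow_le_two hz1 m
  have h3 : ‖1 + z‖ ^ P ≤ 2 ^ P * |cos θ| ^ (2 * b) := by
    rw [hx, mul_pow, ← rpow_natCast |cos θ|]
    refine mul_le_mul_of_nonneg_left ?_ (by positivity)
    rcases (abs_nonneg (cos θ)).eq_or_lt with h0 | hpos
    · rw [← h0, zero_rpow (by exact_mod_cast hP0)]
      positivity
    · exact rpow_le_rpow_of_exponent_ge hpos (abs_cos_le_one θ) (by linarith)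
  rw [hy, mul_rpow two_pos.le (abs_nonneg _)] at h2
  calc _ ≤ (2 ^ P * |cos θ| ^ (2 * b))
        * ((1 + 2 ^ (P + 2)) * (2 ^ (2 * a) * |sin θ| ^ (2 * a))) := by gcongr
    _ = _ := by rw [circWeight]; ring

theorem integral_cos_int_mul_two_mul {n : ℤ} (hn : n ≠ 0) :
    ∫ θ in (0 : ℝ)..π, cos (n * (2 * θ)) = 0 := by
  have hn' : (2 * n : ℝ) ≠ 0 := by
    have : (n : ℝ) ≠ 0 := by exact_mod_cast hn
    positivity
  have h := intervalIntegral.integral_comp_mul_left (a := 0) (b := π) cos hn'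
  have h1 : sin (2 * (n : ℝ) * π) = 0 := by
    have := sin_int_mul_pi (2 * n)
    push_cast at this
    exact this
  rw [integral_cos, h1, mul_zero, sin_zero, sub_zero, smul_zero] at h
  refine Eq.trans (intervalIntegral.integral_congr fun θ _ => ?_) h
  ring_nf

theorem integral_cos_mul_cos {p k : ℕ} (hk : 1 ≤ k) :
    ∫ θ in (0 : ℝ)..π, cos (p * (2 * θ)) * cos (k * (2 * θ)) = if p = k then π / 2 else 0 := by
  have h : ∀ θ : ℝ, cos (p * (2 * θ)) * cos (k * (2 * θ))
      = (cos (((p : ℤ) - k : ℤ) * (2 * θ)) + cos (((p : ℤ) + k : ℤ) * (2 * θ))) / 2 := by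
    intro θ
    push_cast
    rw [sub_mul, add_mul, cos_sub, cos_add]
    ring
  simp only [h]
  rw [intervalIntegral.integral_div, intervalIntegral.integral_add
    (Continuous.intervalIntegrable (by fun_prop) _ _)
    (Continuous.intervalIntegrable (by fun_prop) _ _),
    integral_cos_int_mul_two_mul (n := (p : ℤ) + k) (by omega)]
  split_ifs with hpk
  · simp [hpk]
  · rw [integral_cos_int_mul_two_mul (by omega)]
    simp

open Polynomial in
theorem jacPoly_eval_cos (a b : ℝ) (j : ℕ) (φ : ℝ) :
    (jacPoly a b j).eval (cos φ)
      = ∑ r ∈ range j, jacCoef a b j r * cos ((j - r : ℕ) * φ) + jacCoef a b j j / 2 := by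
  simp only [jacPoly, eval_add, eval_finsetSum, eval_smul, eval_one, smul_eq_mul, mul_one,
    Chebyshev.T_real_cos]
  congr 1
  refine sum_congr rfl fun r hr => ?_
  rw [Nat.cast_sub (mem_range.1 hr).le]
  push_cast
  rfl

theorem integral_jacPoly_mul_cos (a b : ℝ) {j k : ℕ} (hk : 1 ≤ k) :
    ∫ θ in (0 : ℝ)..π, (jacPoly a b j).eval (cos (2 * θ)) * cos (k * (2 * θ))
      = if k ≤ j then π / 2 * jacCoef a b j (j - k) else 0 := by
  have h0 : ∫ θ in (0 : ℝ)..π, cos (k * (2 * θ)) = 0 :=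
    integral_cos_int_mul_two_mul (n := k) (by omega)
  simp only [jacPoly_eval_cos, add_mul, sum_mul, mul_assoc]
  rw [intervalIntegral.integral_add (Continuous.intervalIntegrable (by fun_prop) _ _)
    (Continuous.intervalIntegrable (by fun_prop) _ _), intervalIntegral.integral_finsetSum
    (fun r _ => Continuous.intervalIntegrable (by fun_prop) _ _),
    intervalIntegral.integral_const_mul, h0, mul_zero, add_zero]
  simp only [intervalIntegral.integral_const_mul, integral_cos_mul_cos hk]
  split_ifs with hkj
  · rw [sum_eq_single_of_mem (j - k) (mem_range.2 (by omega))]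
    · rw [if_pos (by omega), mul_comm]
    · intro r hr hne
      have := mem_range.1 hr
      rw [if_neg (by omega), mul_zero]
  · refine sum_eq_zero fun r _ => ?_
    rw [if_neg (by omega), mul_zero]

theorem integral_jacPoly_mul_trigTest (a b : ℝ) (P m j : ℕ) {s : ℕ} (hs : 1 ≤ s) :
    ∫ θ in (0 : ℝ)..π, (jacPoly a b j).eval (cos (2 * θ)) * trigTest P m s (2 * θ)
      = ∑ i ∈ range ((testPoly P m).natDegree + 1), (testPoly P m).coeff i *
        if s + i ≤ j then π / 2 * jacCoef a b j (j - (s + i)) else 0 := by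
  simp only [trigTest, mul_sum]
  rw [intervalIntegral.integral_finsetSum
    (fun r _ => Continuous.intervalIntegrable (by fun_prop) _ _)]
  refine sum_congr rfl fun i _ => ?_
  rw [← integral_jacPoly_mul_cos a b (by omega : 1 ≤ s + i), ← intervalIntegral.integral_const_mul]
  refine intervalIntegral.integral_congr fun θ _ => ?_
  ring_nf

theorem le_integral_jacPoly_mul_trigTest {a b : ℝ} (hb : 0 ≤ b) (hab : b ≤ a) (P : ℕ) {m j s : ℕ}
    (hs : 1 ≤ s) (hj : j < s + m) :
    π / 2 * (if s ≤ j then ∑ r ∈ range (j - s + 1), jacCoef a b j r else 0)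
      ≤ ∫ θ in (0 : ℝ)..π, (jacPoly a b j).eval (cos (2 * θ)) * trigTest P m s (2 * θ) := by
  rw [integral_jacPoly_mul_trigTest a b P m j hs]
  have hpi := pi_pos
  split_ifs with hsj
  · have hd : j - s ≤ (testPoly P m).natDegree := by
      refine Polynomial.le_natDegree_of_ne_zero ?_
      have := one_le_coeff_testPoly P (show j - s < m by omega)
      linarith
    rw [← sum_range_reflect, mul_sum]
    refine (sum_le_sum (g := fun i => (testPoly P m).coeff i *
        if s + i ≤ j then π / 2 * jacCoef a b j (j - (s + i)) else 0) ?_).trans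
      (sum_le_sum_of_subset_of_nonneg (range_subset_range.2 (Nat.succ_le_succ hd)) ?_)
    · intro i hi
      have hi' := mem_range.1 hi
      have h1 := one_le_coeff_testPoly P (show i < m by omega)
      rw [if_pos (by omega), show j - s + 1 - 1 - i = j - (s + i) by omega]
      have h2 := jacCoef_nonneg (j := j) hb hab (j - (s + i)) (Nat.sub_le _ _)
      exact le_mul_of_one_le_left (by positivity) h1
    · intro i _ hi
      have hi' : ¬ i < j - s + 1 := fun h => hi (mem_range.2 h)
      rw [if_neg (by omega), mul_zero]
  · rw [mul_zero]
    refine (sum_eq_zero fun i _ => ?_).ge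
    rw [if_neg (by omega), mul_zero]

theorem le_integral_jacPoly_mul_testFun {a b : ℝ} (hb : 0 ≤ b) (hab : b ≤ a) (P : ℕ) {N M j : ℕ}
    (hM : M ≤ N) (hj : j ≤ N) :
    π / 2 * ∑ m ∈ Icc 1 M, (if N - m + 1 ≤ j then
        ∑ r ∈ range (j - (N - m + 1) + 1), jacCoef a b j r else 0) / (m : ℝ) ^ (2 * a + 2)
      ≤ ∫ θ in (0 : ℝ)..π, (jacPoly a b j).eval (cos (2 * θ)) * testFun a P N M (2 * θ) := by
  have hcont : ∀ m s, Continuous fun θ : ℝ => trigTest P m s (2 * θ) := by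
    intro m s
    unfold trigTest
    fun_prop
  simp only [testFun, mul_sum, ← mul_div_assoc]
  rw [intervalIntegral.integral_finsetSum
    (fun m _ => by
      have := hcont m (N - m + 1)
      exact Continuous.intervalIntegrable (by fun_prop) _ _)]
  refine sum_le_sum fun m hm => ?_
  rw [intervalIntegral.integral_div]
  have hm' := mem_Icc.1 hm
  exact div_le_div_of_nonneg_right
    (le_integral_jacPoly_mul_trigTest hb hab P (by omega) (by omega)) (by positivity)

/-- The lower bound for the pairing of the Cesàro kernel with `testFun`. -/
noncomputable def pairSum (a b δ : ℝ) (n M : ℕ) : ℝ :=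
  ∑ m ∈ Icc 1 M, (∑ i ∈ range m, cesA δ (n - 2 * (n / 2 - m + 1 + i))
    * (jacPoly a b (n / 2 - m + 1 + i)).eval 1
    * ∑ r ∈ range (i + 1), jacCoef a b (n / 2 - m + 1 + i) r) / (m : ℝ) ^ (2 * a + 2)

theorem pairSum_eq (a b δ : ℝ) {n M : ℕ} (hM : M ≤ n / 2) :
    pairSum a b δ n M = ∑ j ∈ range (n / 2 + 1), cesA δ (n - 2 * j) * (jacPoly a b j).eval 1 *
      ∑ m ∈ Icc 1 M, (if n / 2 - m + 1 ≤ j then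
        ∑ r ∈ range (j - (n / 2 - m + 1) + 1), jacCoef a b j r else 0) / (m : ℝ) ^ (2 * a + 2) := by
  simp only [mul_sum, ← mul_div_assoc]
  rw [sum_comm, pairSum]
  refine sum_congr rfl fun m hm => ?_
  have hm' := mem_Icc.1 hm
  rw [← sum_div]
  congr 1
  rw [show n / 2 + 1 = n / 2 - m + 1 + m by omega, sum_range_add]
  symm
  rw [sum_eq_zero, zero_add]
  · refine sum_congr rfl fun i _ => ?_
    rw [if_pos (by omega), show n / 2 - m + 1 + i - (n / 2 - m + 1) = i by omega]
  · intro j hj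
    have := mem_range.1 hj
    rw [if_neg (by omega), mul_zero]

open Polynomial in
theorem pairSum_le_TGG {l m a b ε : ℝ} (hl : 0 ≤ l) (hm : 0 ≤ m) (hb : 0 ≤ b) (hab : b ≤ a)
    (hε : ε * ε = 1)
    (hJ : ∀ f : ℝ[X], ∫ θ in (0 : ℝ)..π, f.eval (ε * cos (2 * θ)) * circWeight l m θ
      = jacInt (hb.trans hab) hb f)
    {p : ℕ → ℝ[X]} (hdeg : ∀ k, (p k).degree = k)
    (horth : ∀ j k, gegInt hl hm (p j * p k) = if j = k then 1 else 0)
    {t : ℝ} (ht : ε * (2 * t ^ 2 - 1) = 1) {δ : ℝ} (hδ : -1 < δ) {n M P : ℕ} (hM : M ≤ n / 2)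
    {g : ℝ → ℝ} (hg : Continuous g) (hgs : ∀ θ, g (π - θ) = g θ) {B : ℝ}
    (hgB : ∀ θ, |g θ| ≤ B * circWeight l m θ)
    (hgI : ∀ f : ℝ[X], ∫ θ in (0 : ℝ)..π, f.eval (ε * cos (2 * θ)) * g θ
      = ∫ θ in (0 : ℝ)..π, f.eval (cos (2 * θ)) * testFun a P (n / 2) M (2 * θ)) :
    (cesA δ n)⁻¹ * pairSum a b δ n M ≤ 2 * B * TGG p l m δ n t := by
  have hI : ∀ j ≤ n / 2, _ := fun j hj => le_integral_jacPoly_mul_testFun hb hab P hM hj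
  have hpi := pi_pos
  have hE : ∀ j, 0 ≤ ∑ m ∈ Icc 1 M, (if n / 2 - m + 1 ≤ j then
        ∑ r ∈ range (j - (n / 2 - m + 1) + 1), jacCoef a b j r else 0) / (m : ℝ) ^ (2 * a + 2) := by
    intro j
    refine sum_nonneg fun m hm => div_nonneg ?_ (by positivity)
    split_ifs
    · refine sum_nonneg fun r hr => jacCoef_nonneg hb hab r ?_
      have := mem_range.1 hr
      omega
    · exact le_rfl
  have h := sum_jacPoly_integral_le_TGG hl hm hb hab hε hJ hdeg horth ht hδ n hg hgs hgB
    (fun j hj => by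
      rw [hgI]
      exact le_trans (mul_nonneg (by positivity) (hE j)) (hI j hj))
  have h2 : (cesA δ n)⁻¹ * (π / 2 * pairSum a b δ n M) ≤ π * B * TGG p l m δ n t := by
    refine le_trans (mul_le_mul_of_nonneg_left ?_ (inv_nonneg.2 (cesA_pos hδ n).le)) h
    rw [pairSum_eq a b δ hM, mul_sum]
    refine sum_le_sum fun j hj => ?_
    rw [hgI, mul_left_comm]
    exact mul_le_mul_of_nonneg_left (hI j (Nat.lt_succ_iff.1 (mem_range.1 hj)))
      (mul_nonneg (cesA_pos hδ _).le (jacPoly_eval_one_pos hb hab j).le)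
  nlinarith

theorem integral_add_half_pi {f : ℝ → ℝ} (hf : Function.Periodic f π) :
    ∫ θ in (0 : ℝ)..π, f (θ + π / 2) = ∫ θ in (0 : ℝ)..π, f θ := by
  rw [intervalIntegral.integral_comp_add_right f]
  have h := hf.intervalIntegral_add_eq (π / 2) 0
  rw [zero_add] at h
  rw [zero_add, add_comm π, h]

theorem circWeight_add_half_pi (a b θ : ℝ) : circWeight a b (θ + π / 2) = circWeight b a θ := by
  rw [circWeight, sin_add_pi_div_two, cos_add_pi_div_two, abs_neg, mul_comm, circWeight]

theorem circWeight_periodic (a b : ℝ) : Function.Periodic (circWeight a b) π := by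
  intro θ
  simp [circWeight, sin_add_pi, cos_add_pi]

theorem exists_pairSum_le_TGG {a b : ℝ} (hb : 0 ≤ b) (hab : b ≤ a) {δ : ℝ} (hδ : -1 < δ)
    {p q : ℕ → Polynomial ℝ} (hpdeg : ∀ k, (p k).degree = k)
    (hporth : ∀ j k, gegInt (hb.trans hab) hb (p j * p k) = if j = k then 1 else 0)
    (hqdeg : ∀ k, (q k).degree = k)
    (hqorth : ∀ j k, gegInt hb (hb.trans hab) (q j * q k) = if j = k then 1 else 0) :
    ∃ B : ℝ, 0 < B ∧ ∀ n M : ℕ, M ≤ n / 2 →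
      (cesA δ n)⁻¹ * pairSum a b δ n M ≤ B * TGG p a b δ n 1 ∧
      (cesA δ n)⁻¹ * pairSum a b δ n M ≤ B * TGG q b a δ n 0 := by
  have ha := hb.trans hab
  obtain ⟨P, hP⟩ := exists_nat_ge (2 * a + 1)
  have hcos : ∀ θ : ℝ, cos (2 * (θ + π / 2)) = -1 * cos (2 * θ) := by
    intro θ
    rw [show 2 * (θ + π / 2) = 2 * θ + π by ring, cos_add_pi]
    ring
  have hper : ∀ f : Polynomial ℝ, ∀ w : ℝ → ℝ, Function.Periodic w π →
      Function.Periodic (fun θ => f.eval (cos (2 * θ)) * w θ) π := by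
    intro f w hw θ
    simp only [hw θ, mul_add, cos_add_two_pi]
  refine ⟨2 * (2 ^ P * ((1 + 2 ^ (P + 2)) * 2 ^ (2 * a))), by positivity, fun n M hM => ⟨?_, ?_⟩⟩
  · have hc := continuous_testFun a P (n / 2) M
    refine pairSum_le_TGG (ε := 1) (P := P) ha hb hb hab (by norm_num) (fun f => ?_) hpdeg hporth
      (by norm_num) hδ hM (g := fun θ => testFun a P (n / 2) M (2 * θ)) (by fun_prop) (fun θ => ?_)
      (fun θ => abs_testFun_le hb hab hP _ _ _) (fun f => ?_)
    · simp only [one_mul, jacInt_apply]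
    · calc testFun a P (n / 2) M (2 * (π - θ))
          = testFun a P (n / 2) M (-(2 * θ) + 2 * π) := by ring_nf
        _ = testFun a P (n / 2) M (2 * θ) := by rw [testFun_add_two_pi, testFun_neg]
    · simp only [one_mul]
  · have hc := continuous_testFun a P (n / 2) M
    refine pairSum_le_TGG (ε := -1) (P := P) hb ha hb hab (by norm_num) (fun f => ?_) hqdeg hqorth
      (by norm_num) hδ hM (g := fun θ => testFun a P (n / 2) M (2 * (θ + π / 2))) (by fun_prop)
      (fun θ => ?_) (fun θ => ?_) (fun f => ?_)
    · simp only [← hcos, ← circWeight_add_half_pi a b, jacInt_apply]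
      exact integral_add_half_pi (hper f _ (circWeight_periodic a b))
    · calc testFun a P (n / 2) M (2 * (π - θ + π / 2))
          = testFun a P (n / 2) M (-(2 * (θ + π / 2)) + 2 * π + 2 * π) := by ring_nf
        _ = testFun a P (n / 2) M (2 * (θ + π / 2)) := by
          rw [testFun_add_two_pi, testFun_add_two_pi, testFun_neg]
    · rw [← circWeight_add_half_pi a b]
      exact abs_testFun_le hb hab hP _ _ _
    · simp only [← hcos]
      exact integral_add_half_pi (hper f (fun θ => testFun a P (n / 2) M (2 * θ)) fun θ => by
        simp only [mul_add, testFun_add_two_pi])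

theorem rpow_le_two_rpow_abs_mul {x y : ℝ} (d : ℝ) (hx : 0 < x) (hxy : x ≤ y) (hy : y ≤ 2 * x) :
    y ^ d ≤ 2 ^ |d| * x ^ d := by
  have h1 : (y / x) ^ d ≤ 2 ^ |d| := by
    have h2 : 1 ≤ y / x := by rwa [le_div_iff₀ hx, one_mul]
    calc (y / x) ^ d ≤ (y / x) ^ |d| := rpow_le_rpow_of_exponent_le h2 (le_abs_self d)
      _ ≤ 2 ^ |d| := rpow_le_rpow (by linarith) (by rwa [div_le_iff₀ hx]) (abs_nonneg d)
  rw [div_rpow (by linarith) hx.le, div_le_iff₀ (by positivity)] at h1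
  exact h1

theorem exists_inv_cesA_ge {d : ℝ} (hd : -1 < d) :
    ∃ c : ℝ, 0 < c ∧ ∀ n : ℕ, 1 ≤ n → c * (n : ℝ) ^ (-d) ≤ (cesA d n)⁻¹ := by
  obtain ⟨_, C, _, hC, h⟩ := exists_cesA_bounds hd
  refine ⟨(C * 2 ^ |d|)⁻¹, by positivity, fun n hn => ?_⟩
  have hn' : (1 : ℝ) ≤ n := by exact_mod_cast hn
  rw [rpow_neg (by linarith), ← mul_inv]
  refine inv_anti₀ (cesA_pos hd n) ((h n).2.trans ?_)
  rw [mul_assoc]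
  refine mul_le_mul_of_nonneg_left ?_ hC.le
  exact rpow_le_two_rpow_abs_mul d (by linarith) (by linarith) (by linarith)

theorem exists_rpow_le_pairSum {a b : ℝ} (hb : 0 ≤ b) (hab : b ≤ a) {δ : ℝ} (hδ : -1 < δ) :
    ∃ c : ℝ, 0 < c ∧ ∀ n : ℕ, 2 ≤ n →
      c * (n : ℝ) ^ (a - δ) ≤ (cesA δ n)⁻¹ * pairSum a b δ n 1 := by
  have ha := hb.trans hab
  obtain ⟨c1, hc1, h1⟩ := exists_inv_cesA_ge hδ
  obtain ⟨c2, hc2, h2⟩ := exists_jacPoly_eval_one_ge hb hab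
  have hA0 := cesA_pos hδ 0
  have hA1 := cesA_pos hδ 1
  have hc3 : 0 < min (cesA δ 0) (cesA δ 1) := lt_min hA0 hA1
  refine ⟨c1 * (min (cesA δ 0) (cesA δ 1) * (c2 * (1 / 2) ^ a)), by positivity, fun n hn => ?_⟩
  have hn' : (2 : ℝ) ≤ n := by exact_mod_cast hn
  have hpair : pairSum a b δ n 1 = cesA δ (n - 2 * (n / 2)) * (jacPoly a b (n / 2)).eval 1 := by
    simp [pairSum, jacCoef_zero, show n / 2 - 1 + 1 = n / 2 by omega]
  have h3 : min (cesA δ 0) (cesA δ 1) ≤ cesA δ (n - 2 * (n / 2)) := by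
    rcases (by omega : n - 2 * (n / 2) = 0 ∨ n - 2 * (n / 2) = 1) with h | h <;> rw [h]
    · exact min_le_left _ _
    · exact min_le_right _ _
  have h4 : c2 * (1 / 2) ^ a * (n : ℝ) ^ a ≤ (jacPoly a b (n / 2)).eval 1 := by
    refine le_trans ?_ (h2 (n / 2))
    rw [mul_assoc, ← mul_rpow (by norm_num) (by linarith)]
    refine mul_le_mul_of_nonneg_left (rpow_le_rpow (by positivity) ?_ ha) hc2.le
    have : n ≤ 2 * (n / 2 + 1) := by omega
    have : (n : ℝ) ≤ 2 * (((n / 2 : ℕ) : ℝ) + 1) := by exact_mod_cast this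
    linarith
  rw [hpair, sub_eq_neg_add, rpow_add (by linarith)]
  calc _ = (c1 * (n : ℝ) ^ (-δ)) * (min (cesA δ 0) (cesA δ 1)
        * (c2 * (1 / 2) ^ a * (n : ℝ) ^ a)) := by ring
    _ ≤ _ := by
      gcongr
      · exact inv_nonneg.2 (cesA_pos hδ n).le
      · exact h1 n (by omega)
      · exact (cesA_pos hδ _).le

theorem sum_rpow_mul_rpow_ge {a : ℝ} (ha : 0 ≤ a) (m : ℕ) :
    (1 / 4) ^ (2 * a) * (1 / 2) * (m : ℝ) ^ (2 * a + 1)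
      ≤ ∑ i ∈ range m, ((m : ℝ) - i) ^ a * ((i : ℝ) + 1) ^ a := by
  rcases Nat.eq_zero_or_pos m with rfl | hm
  · have : (2 * a + 1 : ℝ) ≠ 0 := by linarith
    simp [this]
  have hm0 : (0 : ℝ) < m := by exact_mod_cast hm
  have hsub : Ico (m / 4) (m - m / 4) ⊆ range m := by
    intro i hi
    have := mem_Ico.1 hi
    exact mem_range.2 (by omega)
  refine le_trans ?_ (sum_le_sum_of_subset_of_nonneg hsub fun i hi _ => ?_)
  · have hterm : ∀ i ∈ Ico (m / 4) (m - m / 4),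
        (1 / 4 * (m : ℝ)) ^ (2 * a) ≤ ((m : ℝ) - i) ^ a * ((i : ℝ) + 1) ^ a := by
      intro i hi
      have hi' := mem_Ico.1 hi
      have e1 : m ≤ 4 * (i + 1) := by omega
      have e2 : m + 4 * i ≤ 4 * m := by omega
      have e1' : (m : ℝ) ≤ 4 * ((i : ℝ) + 1) := by exact_mod_cast e1
      have e2' : (m : ℝ) + 4 * i ≤ 4 * m := by exact_mod_cast e2
      rw [two_mul, rpow_add (by positivity)]
      have hmi : (0 : ℝ) ≤ m - i := by linarith
      have := rpow_nonneg hmi a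
      gcongr <;> linarith
    refine le_trans ?_ (card_nsmul_le_sum _ _ _ hterm)
    rw [Nat.card_Ico, nsmul_eq_mul, mul_rpow (by norm_num) hm0.le, rpow_add_one hm0.ne']
    have hcard : (1 / 2 * m : ℝ) ≤ ((m - m / 4 - m / 4 : ℕ) : ℝ) := by
      have : m ≤ 2 * (m - m / 4 - m / 4) := by omega
      have : (m : ℝ) ≤ 2 * ((m - m / 4 - m / 4 : ℕ) : ℝ) := by exact_mod_cast this
      linarith
    calc _ = (1 / 2 * m : ℝ) * ((1 / 4) ^ (2 * a) * (m : ℝ) ^ (2 * a)) := by ring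
      _ ≤ _ := by gcongr
  · have : (i : ℝ) ≤ m := by exact_mod_cast (mem_range.1 hi).le
    have : (0 : ℝ) ≤ m - i := by linarith
    positivity

theorem exists_log_le_pairSum {a b : ℝ} (hb : 0 ≤ b) (hab : b ≤ a) :
    ∃ c : ℝ, 0 < c ∧ ∃ n₀ : ℕ, 2 ≤ n₀ ∧ ∀ n : ℕ, n₀ ≤ n → ∃ M ≤ n / 2,
      c * log n ≤ (cesA a n)⁻¹ * pairSum a b a n M := by
  have ha := hb.trans hab
  have ha1 : -1 < a := by linarith
  obtain ⟨c1, hc1, h1⟩ := exists_inv_cesA_ge ha1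
  obtain ⟨c2, hc2, h2⟩ := exists_jacPoly_eval_one_ge hb hab
  obtain ⟨c3, _, hc3, _, h3⟩ := exists_cesA_bounds ha1
  obtain ⟨c4, hc4, D, hD, h4⟩ := exists_jacCoef_sum_ge hb hab
  set K : ℝ := c3 * (c2 * (1 / 4) ^ a) * c4 * ((1 / 4) ^ (2 * a) * (1 / 2)) with hK
  have hK0 : 0 < K := by positivity
  have hDD : 4 ≤ D * D := Nat.mul_le_mul hD hD
  refine ⟨c1 * K / 2, by positivity, 64 * (D * D), by omega,
    fun n hn => ⟨n / 2 / (2 * D), Nat.div_le_self _ _, ?_⟩⟩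
  set M := n / 2 / (2 * D) with hMdef
  have hn2 : 2 ≤ n := by omega
  have hn0 : (2 : ℝ) ≤ n := by exact_mod_cast hn2
  have hMD : M * (2 * D) ≤ n / 2 := Nat.div_mul_le_self _ _
  have hMM : 2 * M ≤ n / 2 := le_trans (by nlinarith) hMD
  have hlow : ∀ m ∈ Icc 1 M, K * (n : ℝ) ^ a * (m : ℝ)⁻¹ ≤
      (∑ i ∈ range m, cesA a (n - 2 * (n / 2 - m + 1 + i))
        * (jacPoly a b (n / 2 - m + 1 + i)).eval 1
        * ∑ r ∈ range (i + 1), jacCoef a b (n / 2 - m + 1 + i) r) / (m : ℝ) ^ (2 * a + 2) := by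
    intro m hm
    have hm' := mem_Icc.1 hm
    have hm0 : (0 : ℝ) < m := by exact_mod_cast hm'.1
    rw [le_div_iff₀ (by positivity)]
    have hterm : ∀ i ∈ range m, c3 * (c2 * (1 / 4) ^ a * (n : ℝ) ^ a) * c4 *
        (((m : ℝ) - i) ^ a * ((i : ℝ) + 1) ^ a) ≤ cesA a (n - 2 * (n / 2 - m + 1 + i))
        * (jacPoly a b (n / 2 - m + 1 + i)).eval 1
        * ∑ r ∈ range (i + 1), jacCoef a b (n / 2 - m + 1 + i) r := by
      intro i hi
      have hi' := mem_range.1 hi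
      set j := n / 2 - m + 1 + i with hj
      have hile : (0 : ℝ) ≤ m - i := by
        have : (i : ℝ) ≤ m := by exact_mod_cast hi'.le
        linarith
      have e1 : c3 * ((m : ℝ) - i) ^ a ≤ cesA a (n - 2 * j) := by
        refine le_trans (mul_le_mul_of_nonneg_left (rpow_le_rpow hile ?_ ha) hc3.le) (h3 _).1
        have : m ≤ n - 2 * j + 1 + i := by omega
        have : (m : ℝ) ≤ ((n - 2 * j : ℕ) : ℝ) + 1 + i := by exact_mod_cast this
        linarith
      have e2 : c2 * (1 / 4) ^ a * (n : ℝ) ^ a ≤ (jacPoly a b j).eval 1 := by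
        refine le_trans ?_ (h2 j)
        rw [mul_assoc, ← mul_rpow (by norm_num) (by linarith)]
        refine mul_le_mul_of_nonneg_left (rpow_le_rpow (by positivity) ?_ ha) hc2.le
        have : n ≤ 4 * (j + 1) := by omega
        have : (n : ℝ) ≤ 4 * ((j : ℝ) + 1) := by exact_mod_cast this
        linarith
      have e3 : c4 * ((i : ℝ) + 1) ^ a ≤ ∑ r ∈ range (i + 1), jacCoef a b j r := by
        refine h4 j i ?_
        have h5 : i * D ≤ M * D := Nat.mul_le_mul_right D (by omega)
        have h6 : 2 * (M * D) ≤ n / 2 := by linarith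
        omega
      calc _ = (c3 * ((m : ℝ) - i) ^ a) * (c2 * (1 / 4) ^ a * (n : ℝ) ^ a)
            * (c4 * ((i : ℝ) + 1) ^ a) := by ring
        _ ≤ _ := by
          have := (cesA_pos ha1 (n - 2 * j)).le
          have := (jacPoly_eval_one_pos hb hab j).le
          gcongr
    refine le_trans ?_ (sum_le_sum hterm)
    rw [← mul_sum]
    refine le_trans (le_of_eq ?_)
      (mul_le_mul_of_nonneg_left (sum_rpow_mul_rpow_ge ha m) (by positivity))
    rw [show 2 * a + 2 = (2 * a + 1) + 1 by ring, rpow_add_one hm0.ne' (2 * a + 1), hK]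
    field_simp
  have hpair : K * (n : ℝ) ^ a * (log n / 2) ≤ pairSum a b a n M := by
    refine le_trans ?_ (sum_le_sum hlow)
    rw [← mul_sum]
    refine mul_le_mul_of_nonneg_left ?_ (by positivity)
    have hharm : log ((M + 1 : ℕ) : ℝ) ≤ ∑ m ∈ Icc 1 M, (m : ℝ)⁻¹ := by
      have := log_add_one_le_harmonic M
      rw [harmonic_eq_sum_Icc] at this
      push_cast at this ⊢
      exact this
    refine le_trans ?_ hharm
    have hsq : (n : ℝ) ≤ ((M + 1 : ℕ) : ℝ) ^ 2 := by
      have e1 : n / 2 < (M + 1) * (2 * D) := by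
        have := Nat.lt_div_mul_add (a := n / 2) (b := 2 * D) (by omega)
        rw [add_mul, one_mul]
        exact this
      have e2 : n ≤ (M + 1) * (8 * D) := by linarith [(by omega : n ≤ 2 * (n / 2) + 2)]
      have e3 : n * (64 * (D * D)) ≤ (M + 1) ^ 2 * (64 * (D * D)) := by
        calc n * (64 * (D * D)) ≤ n * n := Nat.mul_le_mul_left n hn
          _ ≤ (M + 1) * (8 * D) * ((M + 1) * (8 * D)) := Nat.mul_le_mul e2 e2
          _ = _ := by ring
      exact_mod_cast Nat.le_of_mul_le_mul_right e3 (by omega)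
    have := log_le_log (by linarith) hsq
    rw [log_pow] at this
    push_cast at this ⊢
    linarith
  calc c1 * K / 2 * log n = (c1 * (n : ℝ) ^ (-a)) * (K * (n : ℝ) ^ a * (log n / 2)) := by
        rw [rpow_neg (by linarith)]
        field_simp
    _ ≤ _ := by
      have := log_nonneg (show (1 : ℝ) ≤ n by linarith)
      gcongr
      · exact inv_nonneg.2 (cesA_pos ha1 n).le
      · exact h1 n (by omega)

/-- Proposition 2.6: for `μ ≥ 0`, `λ ≥ μ`, `-1 < δ ≤ λ`, if `p` and `q`
are the orthonormal polynomial families for `w_{λ,μ}` resp. `w_{μ,λ}`, then for `n ≥ 2`: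
`T_n^δ(w_{λ,μ};1), T_n^δ(w_{μ,λ};0) ≥ c log n` if `δ = λ`, and `≥ c n^{λ-δ}` if
`-1 < δ < λ`. -/
theorem lower_bound_TGG (lam mu δ : ℝ) (hmu : 0 ≤ mu) (hml : mu ≤ lam)
    (hδ1 : -1 < δ) (hδ2 : δ ≤ lam)
    (p q : ℕ → Polynomial ℝ)
    (hpdeg : ∀ k, (p k).degree = k) (hplead : ∀ k, 0 < (p k).leadingCoeff)
    (hporth : ∀ j k, (∫ t in (-1 : ℝ)..1, (p j).eval t * (p k).eval t * wGG lam mu t) =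
      if j = k then 1 else 0)
    (hqdeg : ∀ k, (q k).degree = k) (hqlead : ∀ k, 0 < (q k).leadingCoeff)
    (hqorth : ∀ j k, (∫ t in (-1 : ℝ)..1, (q j).eval t * (q k).eval t * wGG mu lam t) =
      if j = k then 1 else 0) :
    ∃ c : ℝ, 0 < c ∧ ∀ n : ℕ, 2 ≤ n →
      (δ = lam →
        c * Real.log n ≤ TGG p lam mu δ n 1 ∧ c * Real.log n ≤ TGG q mu lam δ n 0) ∧
      (δ < lam →
        c * (n : ℝ) ^ (lam - δ) ≤ TGG p lam mu δ n 1 ∧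
          c * (n : ℝ) ^ (lam - δ) ≤ TGG q mu lam δ n 0) := by
  have hlam := hmu.trans hml
  have hp := gegInt_orthonormal hlam hmu hporth
  have hq := gegInt_orthonormal hmu hlam hqorth
  obtain ⟨B, hB, hT⟩ := exists_pairSum_le_TGG hmu hml hδ1 hpdeg hp hqdeg hq
  rcases hδ2.lt_or_eq with hlt | rfl
  · obtain ⟨c, hc, h⟩ := exists_rpow_le_pairSum hmu hml hδ1
    refine ⟨c / B, by positivity, fun n hn => ⟨fun he => absurd he hlt.ne, fun _ => ?_⟩⟩
    have h1 := hT n 1 (by omega)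
    rw [div_mul_eq_mul_div, div_le_iff₀' hB, div_le_iff₀' hB]
    exact ⟨(h n hn).trans h1.1, (h n hn).trans h1.2⟩
  · obtain ⟨c, hc, n₀, hn₀, h⟩ := exists_log_le_pairSum hmu hml
    have hlog₀ : 0 < log n₀ := log_pos (by exact_mod_cast hn₀)
    refine ⟨min (c / B) (1 / log n₀), lt_min (by positivity) (by positivity),
      fun n hn => ⟨fun _ => ?_, fun hlt => absurd rfl hlt.ne⟩⟩
    have hlog : 0 ≤ log n := log_natCast_nonneg n
    rcases le_or_gt n₀ n with hle | hgt
    · obtain ⟨M, hM, h2⟩ := h n hle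
      have h1 := hT n M hM
      have h3 : min (c / B) (1 / log n₀) * log n ≤ c * log n / B :=
        (mul_le_mul_of_nonneg_right (min_le_left _ _) hlog).trans_eq (div_mul_eq_mul_div _ _ _)
      exact ⟨h3.trans ((div_le_iff₀' hB).2 (h2.trans h1.1)),
        h3.trans ((div_le_iff₀' hB).2 (h2.trans h1.2))⟩
    · have h3 : min (c / B) (1 / log n₀) * log n ≤ 1 := by
        refine (mul_le_mul_of_nonneg_right (min_le_right _ _) hlog).trans ?_
        rw [one_div_mul_eq_div, div_le_one hlog₀]
        exact log_le_log (by positivity) (by exact_mod_cast hgt.le)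
      exact ⟨h3.trans (one_le_TGG hlam hmu hpdeg hp hδ1 n 1),
        h3.trans (one_le_TGG hmu hlam hqdeg hq hδ1 n 0)⟩
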